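/- arXiv:2207.10703 — 6 statements merged into one kernel-verified Lean document; each statement's English description precedes it below -/
import Mathlib

section
/- There exist an absolute constant C > 0 and an absolute constant n₀ such that for every n ≥ n₀ there is a non-empty finite multiset L_n of permutations of [n] with |L_n| ≤ (log₂ n)^C (so the uniform distribution on L_n has Shannon entropy O(log log n)) such that: for every injective assignment of real values v : [n] → ℝ to the n items, the wait-and-pick algorithm with checkpoint ⌊n/e⌋, when the arrival order π is drawn uniformly at random from L_n, selects the item of maximum value with probability at least 1/e − 3(log₂ log₂ n)² / (e·(log₂ n)^{1/2}). -/
open scoped Classical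

/-- The candidate set of the wait-and-pick algorithm with checkpoint `m` on the
observed sequence `w` (positions are 0-based, so 1-based position `t+1 > m`
means `m ≤ t`): all positions after the checkpoint whose value beats every
value seen before the checkpoint. -/
noncomputable def wpCand {n : ℕ} (m : ℕ) (w : Fin n → ℝ) : Finset (Fin n) :=
  Finset.univ.filter (fun t : Fin n =>
    m ≤ (t : ℕ) ∧ ∀ s : Fin n, (s : ℕ) < m → w s < w t)

/-- Success of the wait-and-pick algorithm with checkpoint `m`: it selects the
first candidate position (or the last position if there is none), and succeeds
iff the selected value is the maximum of the whole sequence. -/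
noncomputable def wpSucceeds {n : ℕ} (m : ℕ) (w : Fin n → ℝ) : Prop :=
  if h : (wpCand m w).Nonempty then ∀ s : Fin n, w s ≤ w ((wpCand m w).min' h)
  else ∀ s t : Fin n, (t : ℕ) = n - 1 → w s ≤ w t

section

open Finset

/-- A sufficient condition for success in terms of the positions `s` of the items when the
`k + 1` most valuable items are `T 0, …, T k` in decreasing order of value: some `T i` with `0 < i`
arrives before the checkpoint `m`, while all more valuable items arrive after it, the best item
being the first of them. -/
def bestFirstAfter {n : ℕ} (m k : ℕ) (T : Fin (k + 1) → Fin n) (s : Equiv.Perm (Fin n)) : Prop :=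
  ∃ i, 0 < i ∧ (s (T i) : ℕ) < m ∧ ∀ j < i, m ≤ (s (T j) : ℕ) ∧ s (T 0) ≤ s (T j)

lemma exists_perm_strictAnti {n : ℕ} {v : Fin n → ℝ} (hv : Function.Injective v) :
    ∃ ρ : Equiv.Perm (Fin n), StrictAnti (v ∘ ρ) := by
  refine ⟨Tuple.sort (fun i => -v i), ?_⟩
  have h := Tuple.monotone_sort (fun i => -v i)
  have h' : Antitone (v ∘ Tuple.sort (fun i => -v i)) := fun a b hab => by
    have := h hab
    simpa using this
  exact h'.strictAnti_of_injective (hv.comp (Equiv.injective _))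

lemma wpSucceeds_of_bestFirstAfter {n m k : ℕ} (hk : k + 1 ≤ n) {v : Fin n → ℝ}
    {ρ : Equiv.Perm (Fin n)} (hρ : StrictAnti (v ∘ ρ)) {s : Equiv.Perm (Fin n)}
    (hs : bestFirstAfter m k (fun i => ρ (Fin.castLE hk i)) s) :
    wpSucceeds m (fun t => v (s⁻¹ t)) := by
  obtain ⟨i, hi0, him, hi⟩ := hs
  have hmax : ∀ x, v x ≤ v (ρ (Fin.castLE hk 0)) := fun x => by
    have := hρ.antitone (a := Fin.castLE hk 0) (b := ρ⁻¹ x) (by simp [Fin.le_def])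
    simpa using this
  have hmem : s (ρ (Fin.castLE hk 0)) ∈ wpCand m (fun t => v (s⁻¹ t)) := by
    simp only [wpCand, mem_filter, mem_univ, true_and]
    refine ⟨(hi 0 hi0).1, fun u hu => ?_⟩
    have hne : ρ⁻¹ (s⁻¹ u) ≠ Fin.castLE hk 0 := by
      intro h
      have : u = s (ρ (Fin.castLE hk 0)) := by rw [← h]; simp
      have h2 := (hi 0 hi0).1
      rw [← this] at h2
      omega
    have := hρ (a := Fin.castLE hk 0) (b := ρ⁻¹ (s⁻¹ u))
      (lt_of_le_of_ne (by simp [Fin.le_def]) hne.symm)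
    simpa using this
  have hne : (wpCand m (fun t => v (s⁻¹ t))).Nonempty := ⟨_, hmem⟩
  have hmin : (wpCand m (fun t => v (s⁻¹ t))).min' hne = s (ρ (Fin.castLE hk 0)) := by
    refine le_antisymm (min'_le _ _ hmem) (le_min' _ _ _ fun t ht => ?_)
    simp only [wpCand, mem_filter, mem_univ, true_and] at ht
    have h1 := ht.2 _ him
    have h2 : ρ⁻¹ (s⁻¹ t) < Fin.castLE hk i := by
      rw [← hρ.lt_iff_gt]
      simpa using h1
    have h3 := (hi ⟨ρ⁻¹ (s⁻¹ t), lt_trans (Fin.lt_def.1 h2) i.2⟩ h2).2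
    have h4 : Fin.castLE hk ⟨ρ⁻¹ (s⁻¹ t), lt_trans (Fin.lt_def.1 h2) i.2⟩ = ρ⁻¹ (s⁻¹ t) := rfl
    simpa [h4] using h3
  rw [wpSucceeds, dif_pos hne, hmin]
  simpa using fun u => hmax (s⁻¹ u)

lemma card_bestFirstAfter_comp {n m k : ℕ} (T : Fin (k + 1) → Fin n) (ρ : Equiv.Perm (Fin n)) :
    #{s | bestFirstAfter m k (fun i => ρ (T i)) s} = #{s | bestFirstAfter m k T s} := by
  refine card_equiv (Equiv.mulRight ρ) fun s => ?_
  simp only [mem_filter, mem_univ, true_and]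
  rfl

lemma card_perm_apply_eq {n : ℕ} (x t : Fin n) :
    n * #{s : Equiv.Perm (Fin n) | s x = t} = n.factorial := by
  have h : ∀ u : Fin n, #{s : Equiv.Perm (Fin n) | s x = u} =
      #{s : Equiv.Perm (Fin n) | s x = t} := fun u => by
    refine card_equiv (Equiv.mulLeft (Equiv.swap u t)) fun s => ?_
    simp [Equiv.swap_apply_eq_iff]
  have h2 := card_eq_sum_card_fiberwise (s := (univ : Finset (Equiv.Perm (Fin n))))
    (t := univ) (f := fun s => s x) (by simp)
  simp only [h, sum_const, card_univ, Fintype.card_fin, Fintype.card_perm, smul_eq_mul] at h2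
  exact h2.symm

/-- Given that item `x` is at position `t`, the smallest item at a position before `t` is equally
likely to be at any such position. -/
lemma card_perm_min_before {n : ℕ} (x t u : Fin n) (hu : u < t) :
    n.factorial ≤ n * (t * #{s : Equiv.Perm (Fin n) |
      s x = t ∧ ∀ u' < t, s⁻¹ u ≤ s⁻¹ u'}) := by
  have h : ∀ w ∈ Iio t, #{s : Equiv.Perm (Fin n) | s x = t ∧ ∀ u' < t, s⁻¹ w ≤ s⁻¹ u'} ≤
      #{s : Equiv.Perm (Fin n) | s x = t ∧ ∀ u' < t, s⁻¹ u ≤ s⁻¹ u'} := fun w hw => by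
    rw [mem_Iio] at hw
    refine card_le_card_of_injOn (fun s => Equiv.swap w u * s) (fun s hs => ?_)
      (fun a _ b _ hab => by simpa using hab)
    simp only [coe_filter, mem_univ, true_and, Set.mem_ofPred_eq] at hs ⊢
    refine ⟨by simp [hs.1, Equiv.swap_apply_of_ne_of_ne hw.ne' hu.ne'], fun u' hu' => ?_⟩
    have : Equiv.swap w u u' < t := by
      rw [Equiv.swap_apply_def]
      split_ifs <;> assumption
    simpa using hs.2 _ this
  have hcov : ({s : Equiv.Perm (Fin n) | s x = t} : Finset _) ⊆
      (Iio t).biUnion fun w => {s | s x = t ∧ ∀ u' < t, s⁻¹ w ≤ s⁻¹ u'} := fun s hs => by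
    simp only [mem_filter, mem_univ, true_and] at hs
    obtain ⟨w, hw, hw'⟩ := exists_min_image (Iio t) (fun w => s⁻¹ w) ⟨u, by simpa using hu⟩
    simp only [mem_biUnion, mem_filter, mem_univ, true_and]
    exact ⟨w, hw, hs, fun u' hu' => hw' u' (by simpa using hu')⟩
  have h2 := (card_le_card hcov).trans (card_biUnion_le.trans (sum_le_sum h))
  rw [sum_const, Fin.card_Iio, smul_eq_mul] at h2
  rw [← card_perm_apply_eq x t]
  exact Nat.mul_le_mul_left _ h2

lemma card_perm_late_succ {n m i : ℕ} (hi : i < n) (hm : m ≤ n) :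
    n * #{s : Equiv.Perm (Fin n) | ∀ j : Fin n, (j : ℕ) < i + 1 → m ≤ (s j : ℕ)} ≤
      (n - m) * #{s : Equiv.Perm (Fin n) | ∀ j : Fin n, (j : ℕ) < i → m ≤ (s j : ℕ)} := by
  set A : Finset (Equiv.Perm (Fin n)) := {s | ∀ j : Fin n, (j : ℕ) < i → m ≤ (s j : ℕ)} with hA
  set A' : Finset (Equiv.Perm (Fin n)) := {s | ∀ j : Fin n, (j : ℕ) < i + 1 → m ≤ (s j : ℕ)}
    with hA'
  let x : Fin n := ⟨i, hi⟩
  let early : Finset (Fin n) := {y | (y : ℕ) < m}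
  let late : Finset (Fin n) := {y | ¬ (y : ℕ) < m}
  have hearly : #early = m := by
    simp only [early, Fin.card_filter_val_lt]
    omega
  have hlate : #late = n - m := by
    have := card_filter_add_card_filter_not (s := (univ : Finset (Fin n))) (fun y => (y : ℕ) < m)
    simp only [card_univ, Fintype.card_fin] at this
    change #early + #late = n at this
    omega
  have hsum : ∑ y, #{s ∈ A | s x = y} = #A :=
    (card_eq_sum_card_fiberwise (f := fun s : Equiv.Perm (Fin n) => s x) (by simp)).symm
  have hsplit : ∑ y ∈ early, #{s ∈ A | s x = y} + ∑ y ∈ late, #{s ∈ A | s x = y} = #A := by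
    rw [← hsum]
    exact sum_filter_add_sum_filter_not _ _ _
  have hlatesum : ∑ y ∈ late, #{s ∈ A | s x = y} = #A' := by
    have := card_eq_sum_card_fiberwise (s := A') (t := late)
      (f := fun s : Equiv.Perm (Fin n) => s x) (fun s hs => by
        simp only [hA', coe_filter, mem_univ, true_and, Set.mem_ofPred_eq] at hs
        simpa [late] using hs x (Nat.lt_succ_self i))
    rw [this]
    refine sum_congr rfl fun y hy => congrArg card ?_
    ext s
    simp only [hA, hA', mem_filter, mem_univ, true_and]
    simp only [late, mem_filter, mem_univ, true_and, not_lt] at hy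
    constructor
    · rintro ⟨h, rfl⟩
      refine ⟨fun j hj => ?_, rfl⟩
      rcases Nat.lt_succ_iff_lt_or_eq.1 hj with hj | hj
      · exact h j hj
      · have : j = x := Fin.ext hj
        rwa [this]
    · rintro ⟨h, rfl⟩
      exact ⟨fun j hj => h j (by omega), rfl⟩
  have hle : ∀ y ∈ early, ∀ z ∈ late, #{s ∈ A | s x = z} ≤ #{s ∈ A | s x = y} := by
    intro y hy z hz
    refine card_le_card_of_injOn (fun s => Equiv.swap z y * s) (fun s hs => ?_)
      (fun a _ b _ hab => by simpa using hab)
    simp only [early, late, mem_filter, mem_univ, true_and] at hy hz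
    simp only [hA, coe_filter, mem_filter, mem_univ, true_and, Set.mem_ofPred_eq] at hs ⊢
    refine ⟨fun j hj => ?_, by simp [hs.2]⟩
    have h1 := hs.1 j hj
    have h2 : s j ≠ y := fun h => by rw [h] at h1; omega
    have h3 : s j ≠ z := fun h => by
      have : j = x := s.injective (h.trans hs.2.symm)
      rw [this] at hj
      exact lt_irrefl i hj
    simpa [Equiv.swap_apply_of_ne_of_ne h3 h2] using h1
  have hdouble : m * #A' ≤ (n - m) * ∑ y ∈ early, #{s ∈ A | s x = y} := by
    have : ∑ y ∈ early, ∑ z ∈ late, #{s ∈ A | s x = z} ≤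
        ∑ y ∈ early, ∑ z ∈ late, #{s ∈ A | s x = y} :=
      sum_le_sum fun y hy => sum_le_sum fun z hz => hle y hy z hz
    simpa [hlatesum, hearly, hlate, ← mul_sum] using this
  obtain ⟨d, rfl⟩ := Nat.exists_eq_add_of_le hm
  rw [hlatesum] at hsplit
  simp only [Nat.add_sub_cancel_left] at hdouble ⊢
  rw [← hsplit]
  linarith

lemma card_perm_late_le {n m : ℕ} (hm : m ≤ n) (hn : 0 < n) : ∀ i ≤ n,
    (#{s : Equiv.Perm (Fin n) | ∀ j : Fin n, (j : ℕ) < i → m ≤ (s j : ℕ)} : ℝ) ≤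
      (1 - m / n) ^ i * n.factorial := by
  intro i
  induction i with
  | zero => simp [Fintype.card_perm]
  | succ i ih =>
    intro hi
    have h1 := ih (by omega)
    have h2 : (n : ℝ) * (#{s : Equiv.Perm (Fin n) |
        ∀ j : Fin n, (j : ℕ) < i + 1 → m ≤ (s j : ℕ)} : ℝ) ≤ (n - m) *
        (#{s : Equiv.Perm (Fin n) | ∀ j : Fin n, (j : ℕ) < i → m ≤ (s j : ℕ)} : ℝ) := by
      have := card_perm_late_succ (n := n) (m := m) (i := i) (by omega) hm
      rw [← Nat.cast_sub hm]
      exact_mod_cast this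
    have hn' : (0 : ℝ) < n := by exact_mod_cast hn
    have hm' : (0 : ℝ) ≤ n - m := by
      have : (m : ℝ) ≤ n := by exact_mod_cast hm
      linarith
    have h3 := h2.trans (mul_le_mul_of_nonneg_left h1 hm')
    rw [pow_succ, ← mul_le_mul_iff_right₀ hn']
    refine h3.trans (le_of_eq ?_)
    field_simp

lemma log_div_le_sum_inv {m n : ℕ} (hm : 0 < m) (hmn : m ≤ n) :
    Real.log (n / m) ≤ ∑ t ∈ Ico m n, (1 : ℝ) / t := by
  have hm' : (0 : ℝ) < m := by exact_mod_cast hm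
  induction n, hmn using Nat.le_induction with
  | base => simp [hm'.ne']
  | succ n hn ih =>
    rw [sum_Ico_succ_top hn]
    have hn' : (0 : ℝ) < n := by exact_mod_cast (lt_of_lt_of_le hm hn)
    have h1 : ((n + 1 : ℕ) : ℝ) / m = (n / m) * ((n + 1) / n) := by
      push_cast
      field_simp
    rw [h1, Real.log_mul (by positivity) (by positivity)]
    have h2 := Real.log_le_sub_one_of_pos (x := ((n : ℝ) + 1) / n) (by positivity)
    have h3 : ((n : ℝ) + 1) / n - 1 = 1 / n := by
      field_simp
      ring
    linarith

lemma card_bestFirstAfter_castLE {n m k : ℕ} (hk : k + 1 ≤ n) (hm : 0 < m) (hmn : m ≤ n) :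
    ((m : ℝ) / n * Real.log (n / m) - (1 - m / n) ^ (k + 1)) * n.factorial ≤
      #{s | bestFirstAfter m k (Fin.castLE hk) s} := by
  have hn : 0 < n := by omega
  have hn' : (0 : ℝ) < n := by exact_mod_cast hn
  set A : Finset (Equiv.Perm (Fin n)) := {s | ∀ j : Fin n, (j : ℕ) < k + 1 → m ≤ (s j : ℕ)}
    with hA
  set G : Finset (Equiv.Perm (Fin n)) := {s | bestFirstAfter m k (Fin.castLE hk) s} with hG
  let B (p : Fin n × Fin n) : Finset (Equiv.Perm (Fin n)) :=
    {s | s (Fin.castLE hk 0) = p.1 ∧ ∀ u' < p.1, s⁻¹ p.2 ≤ s⁻¹ u'}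
  let late : Finset (Fin n) := {t | m ≤ (t : ℕ)}
  let early : Finset (Fin n) := {t | (t : ℕ) < m}
  have hearly : #early = m := by
    simp only [early, Fin.card_filter_val_lt]
    omega
  have hsub : (late ×ˢ early).biUnion B ⊆ G ∪ A := by
    intro s hs
    simp only [mem_biUnion, mem_product, Prod.exists, B, late, early, mem_filter, mem_univ,
      true_and] at hs
    obtain ⟨t, u, ⟨ht, hu⟩, h0, hmin⟩ := hs
    rw [mem_union, or_iff_not_imp_right]
    intro hsA
    simp only [hA, mem_filter, mem_univ, true_and, not_forall, not_le, exists_prop] at hsA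
    obtain ⟨j, hj, hjm⟩ := hsA
    obtain ⟨i, him, hi⟩ := exists_minimal_of_wellFoundedLT
      (fun i : Fin (k + 1) => (s (Fin.castLE hk i) : ℕ) < m) ⟨⟨j, hj⟩, hjm⟩
    have hi' : ∀ l < i, m ≤ (s (Fin.castLE hk l) : ℕ) := fun l hl => by
      by_contra h
      exact absurd (hi (not_le.1 h) hl.le) (not_le.2 hl)
    simp only [hG, mem_filter, mem_univ, true_and]
    refine ⟨i, Fin.pos_iff_ne_zero.2 ?_, him, fun l hl => ⟨hi' l hl, ?_⟩⟩
    · rintro rfl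
      rw [h0] at him
      omega
    · rw [h0]
      by_contra! hlt
      have h1 := hmin _ hlt
      have h0 : s⁻¹ (s (Fin.castLE hk l)) = Fin.castLE hk l := by simp
      rw [h0] at h1
      have h2 : ((s⁻¹ u : Fin n) : ℕ) < i := lt_of_le_of_lt h1 hl
      have h3 := hi' ⟨(s⁻¹ u : Fin n), h2.trans i.2⟩ h2
      have h4 : Fin.castLE hk ⟨(s⁻¹ u : Fin n), h2.trans i.2⟩ = s⁻¹ u := rfl
      have h5 : s (s⁻¹ u) = u := by simp
      rw [h4, h5] at h3
      omega
  have hdisj : ((late ×ˢ early : Finset (Fin n × Fin n)) : Set _).PairwiseDisjoint B := by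
    rintro ⟨t, u⟩ hp ⟨t', u'⟩ hp' hne
    rw [Function.onFun, disjoint_left]
    intro s hs hs'
    simp only [coe_product, Set.mem_prod, late, early, coe_filter, mem_univ, true_and,
      Set.mem_ofPred_eq] at hp hp'
    simp only [B, mem_filter, mem_univ, true_and] at hs hs'
    have htt : t = t' := hs.1.symm.trans hs'.1
    subst htt
    have h1 := hs.2 u' (Fin.lt_def.2 (by omega))
    have h2 := hs'.2 u (Fin.lt_def.2 (by omega))
    exact hne (by rw [s⁻¹.injective (le_antisymm h1 h2)])
  have hcard : ∑ p ∈ late ×ˢ early, #(B p) ≤ #G + #A := by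
    rw [← card_biUnion hdisj]
    exact (card_le_card hsub).trans (card_union_le _ _)
  have hB : ∀ p ∈ late ×ˢ early, (n.factorial : ℝ) / n * (1 / (p.1 : ℕ)) ≤ #(B p) := by
    rintro ⟨t, u⟩ hp
    simp only [mem_product, late, early, mem_filter, mem_univ, true_and] at hp
    have h := card_perm_min_before (Fin.castLE hk 0) t u (Fin.lt_def.2 (by omega))
    have ht : (0 : ℝ) < (t : ℕ) := by exact_mod_cast (by omega : 0 < (t : ℕ))
    have h' : (n.factorial : ℝ) ≤ n * ((t : ℕ) * (#(B (t, u)) : ℝ)) := by exact_mod_cast h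
    rw [div_mul_div_comm, mul_one, div_le_iff₀ (by positivity)]
    linarith
  have hlate : ∑ t ∈ late, (1 : ℝ) / (t : ℕ) = ∑ t ∈ Ico m n, (1 : ℝ) / t := by
    simp only [late]
    rw [sum_filter, Fin.sum_univ_eq_sum_range (fun t => if m ≤ t then (1 : ℝ) / t else 0) n,
      ← sum_filter]
    congr 1
    ext t
    simp [and_comm]
  have h1 : (m : ℝ) * (n.factorial / n) * Real.log (n / m) ≤ #G + #A := by
    have h2 := sum_le_sum hB
    rw [sum_product] at h2
    simp only [sum_const, hearly, nsmul_eq_mul] at h2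
    rw [← mul_sum, ← mul_sum, hlate] at h2
    have h3 : ∑ p ∈ late ×ˢ early, (#(B p) : ℝ) ≤ #G + #A := by exact_mod_cast hcard
    have h4 := mul_le_mul_of_nonneg_left (log_div_le_sum_inv hm hmn)
      (by positivity : (0 : ℝ) ≤ m * (n.factorial / n))
    linarith
  have h5 := card_perm_late_le hmn hn (k + 1) hk
  have h6 : (m : ℝ) * (n.factorial / n) * Real.log (n / m) =
      m / n * Real.log (n / m) * n.factorial := by ring
  rw [sub_mul]
  linarith

lemma exp_neg_le_quadratic {x : ℝ} (hx : 0 ≤ x) : Real.exp (-x) ≤ 1 - x + x ^ 2 / 2 := by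
  rw [Real.exp_neg, inv_le_iff_one_le_mul₀ (Real.exp_pos x)]
  have h := Real.quadratic_le_exp_of_nonneg hx
  have h2 : 0 ≤ 1 - x + x ^ 2 / 2 := by nlinarith [sq_nonneg (x - 1)]
  nlinarith [mul_le_mul_of_nonneg_left h h2, sq_nonneg (x ^ 2)]

lemma sum_exp_neg_indicator_le {Ω : Type*} [Fintype Ω] (X : Ω → Prop) {q lam : ℝ}
    (h0 : 0 ≤ lam) (h1 : lam ≤ 1) (hq1 : q ≤ 1)
    (hq : q * Fintype.card Ω ≤ #{ω | X ω}) :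
    ∑ ω, Real.exp (-lam * if X ω then 1 else 0) ≤
      Fintype.card Ω * Real.exp (-q * lam + lam ^ 2 / 2) := by
  have hterm : ∀ ω, Real.exp (-lam * if X ω then 1 else 0) ≤
      1 - (lam - lam ^ 2 / 2) * if X ω then 1 else 0 := fun ω => by
    split_ifs
    · have := exp_neg_le_quadratic h0
      simp only [mul_one]
      linarith
    · simp
  refine (sum_le_sum fun ω _ => hterm ω).trans ?_
  rw [sum_sub_distrib, ← mul_sum, sum_boole]
  simp only [sum_const, card_univ, nsmul_eq_mul, mul_one]
  have h2 : 0 ≤ lam - lam ^ 2 / 2 := by nlinarith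
  have h3 := mul_le_mul_of_nonneg_left hq h2
  have h4 := Real.add_one_le_exp (-q * lam + lam ^ 2 / 2)
  have hc : (0 : ℝ) ≤ Fintype.card Ω := by positivity
  have h5 := mul_le_mul_of_nonneg_left h4 hc
  have h6 := mul_nonneg (mul_nonneg hc (sq_nonneg lam)) (sub_nonneg.2 hq1)
  nlinarith

/-- A Chernoff bound and a union bound: `N` independent uniform samples simultaneously approximate
from below the probabilities of all events of a finite family. -/
lemma exists_sample {Ω ι : Type*} [Fintype Ω] [Nonempty Ω] [Fintype ι] [Nonempty ι]
    (X : ι → Ω → Prop) {q lam : ℝ} (h0 : 0 ≤ lam) (h1 : lam ≤ 1) (hq1 : q ≤ 1) (N : ℕ) :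
    ∃ f : Fin N → Ω, ∀ i, q * Fintype.card Ω ≤ #{ω | X i ω} →
      N * (q * lam - lam ^ 2 / 2) - Real.log (Fintype.card ι) ≤
        lam * #{a | X i (f a)} := by
  let S : Finset ι := {i | q * Fintype.card Ω ≤ #{ω | X i ω}}
  let g (f : Fin N → Ω) (i : ι) : ℝ := ∏ a, Real.exp (-lam * if X i (f a) then 1 else 0)
  let M : ℝ := Fintype.card ι * Real.exp (-q * lam + lam ^ 2 / 2) ^ N
  have hsum : ∑ f : Fin N → Ω, ∑ i ∈ S, g f i ≤ ∑ _f : Fin N → Ω, M := by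
    rw [sum_comm]
    have : ∀ i ∈ S, ∑ f : Fin N → Ω, g f i ≤
        (Fintype.card Ω * Real.exp (-q * lam + lam ^ 2 / 2)) ^ N := fun i hi => by
      simp only [g]
      rw [← Fintype.sum_pow (fun ω => Real.exp (-lam * if X i ω then 1 else 0))]
      refine pow_le_pow_left₀ (sum_nonneg fun _ _ => (Real.exp_pos _).le) ?_ _
      exact sum_exp_neg_indicator_le _ h0 h1 hq1 (by simpa [S] using hi)
    refine (sum_le_sum this).trans ?_
    simp only [sum_const, nsmul_eq_mul, card_univ, Fintype.card_pi, prod_const, Fintype.card_fin,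
      M, mul_pow]
    have hS : (#S : ℝ) ≤ Fintype.card ι := by exact_mod_cast card_le_univ S
    have := mul_le_mul_of_nonneg_right hS
      (by positivity : 0 ≤ (Fintype.card Ω : ℝ) ^ N * Real.exp (-q * lam + lam ^ 2 / 2) ^ N)
    push_cast
    linarith
  obtain ⟨f, -, hf⟩ := exists_le_of_sum_le univ_nonempty hsum
  refine ⟨f, fun i hi => ?_⟩
  have h2 : g f i ≤ M := (single_le_sum (f := g f)
    (fun i _ => prod_nonneg fun _ _ => (Real.exp_pos _).le) (by simpa [S] using hi)).trans hf
  have h3 : g f i = Real.exp (-lam * #{a | X i (f a)}) := by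
    simp only [g]
    rw [← Real.exp_sum, ← mul_sum, sum_boole]
  have hι : (0 : ℝ) < Fintype.card ι := by exact_mod_cast Fintype.card_pos
  have h4 := Real.log_le_log (by rw [h3]; exact Real.exp_pos _) h2
  rw [h3, Real.log_exp, Real.log_mul hι.ne' (by positivity), Real.log_pow, Real.log_exp] at h4
  linarith

lemma exists_perms_bestFirstAfter {n m k : ℕ} (hk : k + 1 ≤ n) (hm : 0 < m) (hmn : m ≤ n)
    {q lam : ℝ} (h0 : 0 ≤ lam) (h1 : lam ≤ 1) (hq1 : q ≤ 1)
    (hq : q ≤ (m : ℝ) / n * Real.log (n / m) - (1 - m / n) ^ (k + 1)) (N : ℕ) :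
    ∃ L : Multiset (Equiv.Perm (Fin n)), Multiset.card L = N ∧
      ∀ v : Fin n → ℝ, Function.Injective v →
        N * (q * lam - lam ^ 2 / 2) - (k + 1) * Real.log n ≤
          lam * (L.countP fun π => wpSucceeds m fun t => v (π t) : ℕ) := by
  have : NeZero n := ⟨by omega⟩
  obtain ⟨f, hf⟩ := exists_sample (bestFirstAfter (n := n) m k) h0 h1 hq1 N
  refine ⟨(univ : Finset (Fin N)).val.map fun a => (f a)⁻¹, by simp, fun v hv => ?_⟩
  obtain ⟨ρ, hρ⟩ := exists_perm_strictAnti hv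
  have h2 := hf (fun i => ρ (Fin.castLE hk i)) (by
    rw [card_bestFirstAfter_comp, Fintype.card_perm, Fintype.card_fin]
    exact (mul_le_mul_of_nonneg_right hq (by positivity)).trans
      (card_bestFirstAfter_castLE hk hm hmn))
  rw [Multiset.countP_map]
  have h3 : #{a | bestFirstAfter m k (fun i => ρ (Fin.castLE hk i)) (f a)} ≤
      #{a | wpSucceeds m fun t => v ((f a)⁻¹ t)} :=
    card_le_card fun a ha => by
      simp only [mem_filter, mem_univ, true_and] at ha ⊢
      exact wpSucceeds_of_bestFirstAfter hk hρ ha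
  have h4 : Real.log (Fintype.card (Fin (k + 1) → Fin n)) = (k + 1) * Real.log n := by
    simp [Real.log_pow]
  rw [h4] at h2
  refine h2.trans (mul_le_mul_of_nonneg_left ?_ h0)
  exact_mod_cast h3

/-- If `log n ≤ K`, the success probability of a suitable sample of size `K ^ 4` is at least
`1 / e - 6 / K`. -/
lemma exists_perms_wpSucceeds {n K : ℕ} (hn : 100 ≤ n) (hK : 4 ≤ K) (hKn : K + 1 ≤ n)
    (hlog : Real.log n ≤ K) :
    ∃ L : Multiset (Equiv.Perm (Fin n)), Multiset.card L = K ^ 4 ∧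
      ∀ v : Fin n → ℝ, Function.Injective v →
        1 / Real.exp 1 - 6 / K ≤
          ((L.countP fun π => wpSucceeds ⌊(n : ℝ) / Real.exp 1⌋₊ fun t => v (π t) : ℕ) : ℝ) /
            Multiset.card L := by
  set m := ⌊(n : ℝ) / Real.exp 1⌋₊ with hm
  have hn' : (100 : ℝ) ≤ n := by exact_mod_cast hn
  have hK' : (4 : ℝ) ≤ K := by exact_mod_cast hK
  have hKn' : (K : ℝ) ≤ n := by exact_mod_cast (by omega : K ≤ n)
  have he := Real.exp_one_lt_d9
  have he' := Real.exp_one_gt_d9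
  have hupper : (m : ℝ) ≤ n / Real.exp 1 := Nat.floor_le (by positivity)
  have hlower : (n : ℝ) / Real.exp 1 < m + 1 := Nat.lt_floor_add_one _
  have hinv : (0.35 : ℝ) ≤ 1 / Real.exp 1 := by
    rw [le_div_iff₀ (by positivity)]
    linarith
  have hinv' : 1 / Real.exp 1 ≤ 1 := by
    rw [div_le_iff₀ (by positivity)]
    linarith
  have hdiv : (n : ℝ) / Real.exp 1 = n * (1 / Real.exp 1) := by ring
  rw [hdiv] at hlower
  have hmn : m ≤ n := by
    have : (m : ℝ) ≤ n := hupper.trans (div_le_self (by linarith) (by linarith))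
    exact_mod_cast this
  have hm3 : (n : ℝ) / 3 ≤ m := by nlinarith
  have hm0 : (0 : ℝ) < m := by linarith
  have hratio : 1 / Real.exp 1 - 1 / n ≤ (m : ℝ) / n := by
    rw [le_div_iff₀ (by linarith), sub_mul, div_mul_cancel₀ _ (by linarith)]
    linarith
  have hlogm : 1 ≤ Real.log (n / m) := by
    rw [Real.le_log_iff_exp_le (by positivity), le_div_iff₀ hm0]
    rw [le_div_iff₀ (by positivity)] at hupper
    linarith
  have htail : (1 - (m : ℝ) / n) ^ (K + 1) ≤ 2 / K := by
    have hle : (m : ℝ) / n ≤ 1 := by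
      rw [div_le_one (by linarith)]
      exact_mod_cast hmn
    have hge : 1 / 3 ≤ (m : ℝ) / n := by
      rw [le_div_iff₀ (by linarith)]
      linarith
    have h1 : (1 - (m : ℝ) / n) ^ (K + 1) ≤ (2 / 3) ^ K :=
      (pow_le_pow_of_le_one (by linarith) (by linarith) (Nat.le_succ K)).trans
        (pow_le_pow_left₀ (by linarith) (by linarith) _)
    refine h1.trans ?_
    have h2 := one_add_mul_le_pow (a := (1 / 2 : ℝ)) (by norm_num) K
    have h3 : ((2 : ℝ) / 3) ^ K * (1 + 1 / 2) ^ K = 1 := by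
      rw [← mul_pow]
      norm_num
    rw [le_div_iff₀ (by linarith)]
    have h4 : (0 : ℝ) < (2 / 3) ^ K := by positivity
    nlinarith
  have hinvn : 1 / (n : ℝ) ≤ 1 / K := one_div_le_one_div_of_le (by linarith) hKn'
  obtain ⟨L, hL, hLv⟩ := exists_perms_bestFirstAfter (q := 1 / Real.exp 1 - 3 / K)
    (lam := 1 / K) hKn (by exact_mod_cast hm0) hmn (by positivity)
    (by rw [div_le_one (by linarith)]; linarith)
    (by have : (0 : ℝ) ≤ 3 / K := by positivity
        linarith)
    (by have h1 : (m : ℝ) / n ≤ m / n * Real.log (n / m) :=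
          le_mul_of_one_le_right (by positivity) hlogm
        have h2 : (3 : ℝ) / K = 1 / K + 2 / K := by ring
        linarith) (K ^ 4)
  refine ⟨L, hL, fun v hv => ?_⟩
  have h := hLv v hv
  rw [hL, le_div_iff₀ (by positivity)]
  push_cast at h ⊢
  set c : ℝ := ((L.countP fun π => wpSucceeds m fun t => v (π t) : ℕ) : ℝ)
  have hK0 : (0 : ℝ) < K := by linarith
  have h5 := mul_le_mul_of_nonneg_left h hK0.le
  have h6 : (K : ℝ) * (1 / K * c) = c := by field_simp
  rw [h6] at h5
  refine le_trans ?_ h5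
  have h7 : (K : ℝ) * (K ^ 4 * ((1 / Real.exp 1 - 3 / K) * (1 / K) - (1 / K) ^ 2 / 2)
      - (K + 1) * Real.log n) =
      1 / Real.exp 1 * K ^ 4 - 3 * K ^ 3 - K ^ 3 / 2 - K * (K + 1) * Real.log n := by
    field_simp
  have h8 : (1 / Real.exp 1 - 6 / K) * (K : ℝ) ^ 4 = 1 / Real.exp 1 * K ^ 4 - 6 * K ^ 3 := by
    field_simp
  rw [h7, h8]
  have h9 := mul_le_mul_of_nonneg_left hlog (by positivity : (0 : ℝ) ≤ K * (K + 1))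
  nlinarith [mul_nonneg (sq_nonneg (K : ℝ)) (sub_nonneg.2 hK')]

end

/-- **Low-entropy free-order classical secretary.**
There are absolute constants `C > 0` and `n₀ ≥ 1` such that for every `n ≥ n₀`
there is a non-empty multiset `L_n` of permutations of `[n]` with
`|L_n| ≤ (log₂ n)^C` (so the uniform distribution on `L_n` has entropy
`O(log log n)`) such that for every injective value assignment `v`, the
wait-and-pick algorithm with checkpoint `⌊n/e⌋`, on an arrival order drawn
uniformly from `L_n`, selects the item of maximum value with probability at
least `1/e − 3(log₂ log₂ n)²/(e·(log₂ n)^{1/2})`. -/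
theorem low_entropy_classical_secretary :
    ∃ C : ℝ, 0 < C ∧ ∃ n₀ : ℕ, 1 ≤ n₀ ∧ ∀ n : ℕ, n₀ ≤ n →
      ∃ L : Multiset (Equiv.Perm (Fin n)), L ≠ 0 ∧
        (Multiset.card L : ℝ) ≤ (Real.logb 2 n) ^ C ∧
        ∀ v : Fin n → ℝ, Function.Injective v →
          1 / Real.exp 1 -
              3 * (Real.logb 2 (Real.logb 2 n)) ^ 2 /
                (Real.exp 1 * Real.sqrt (Real.logb 2 n)) ≤
            ((L.countP (fun π => wpSucceeds (⌊(n : ℝ) / Real.exp 1⌋₊)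
                (fun t => v (π t)))) : ℝ) / (Multiset.card L) := by
  refine ⟨8, by norm_num, 2 ^ 36, by norm_num, fun n hn => ?_⟩
  set l := Real.logb 2 n with hl
  have hn' : ((2 : ℝ) ^ 36) ≤ n := by exact_mod_cast hn
  have hn0 : (0 : ℝ) < n := lt_of_lt_of_le (by positivity) hn'
  have hl36 : 36 ≤ l := by
    rw [hl, Real.le_logb_iff_rpow_le (by norm_num) hn0]
    exact_mod_cast hn'
  set K := ⌈l⌉₊ with hK
  have hlK : l ≤ K := Nat.le_ceil l
  have hKl : (K : ℝ) < l + 1 := Nat.ceil_lt_add_one (by linarith)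
  have hlogl : Real.log n ≤ l := by
    rw [hl, Real.logb]
    refine le_div_self (Real.log_nonneg ?_) (Real.log_pos (by norm_num)) ?_
    · linarith
    · linarith [Real.log_two_lt_d9]
  have hK4 : 4 ≤ K := by
    have : (4 : ℝ) ≤ K := by linarith
    exact_mod_cast this
  have hKn : K + 1 ≤ n := by
    have hpow : (2 : ℝ) ^ l = n := Real.rpow_logb (by norm_num) (by norm_num) hn0
    have h1 : Real.exp (l / 2) ≤ n := by
      rw [← hpow, Real.rpow_def_of_pos (by norm_num), Real.exp_le_exp]
      nlinarith [Real.log_two_gt_d9]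
    have h2 := Real.quadratic_le_exp_of_nonneg (x := l / 2) (by linarith)
    have h3 : (K : ℝ) + 1 ≤ n := by nlinarith
    exact_mod_cast h3
  obtain ⟨L, hL, hLv⟩ := exists_perms_wpSucceeds (n := n) (K := K)
    (le_trans (by norm_num) hn) hK4 hKn (hlogl.trans hlK)
  refine ⟨L, ?_, ?_, fun v hv => le_trans ?_ (hLv v hv)⟩
  · rw [← Multiset.card_pos, hL]
    positivity
  · rw [hL]
    push_cast
    have h1 : (K : ℝ) ≤ l ^ 2 := by nlinarith
    calc (K : ℝ) ^ 4 ≤ (l ^ 2) ^ 4 := pow_le_pow_left₀ (by positivity) h1 4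
      _ = l ^ (8 : ℝ) := by
        rw [← pow_mul]
        norm_cast
  · have hsq : Real.sqrt l * Real.sqrt l = l := Real.mul_self_sqrt (by linarith)
    have hsq6 : 6 ≤ Real.sqrt l := Real.le_sqrt_of_sq_le (by linarith)
    have hlog1 : 1 ≤ Real.logb 2 l := by
      rw [Real.le_logb_iff_rpow_le (by norm_num) (by linarith)]
      norm_num
      linarith
    have he := Real.exp_one_lt_d9
    have he0 := Real.exp_pos 1
    have h1 : (6 : ℝ) / K ≤ 6 / l := div_le_div_of_nonneg_left (by norm_num) (by linarith) hlK
    have h2 : 6 / l ≤ 3 * Real.logb 2 l ^ 2 / (Real.exp 1 * Real.sqrt l) := by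
      rw [div_le_div_iff₀ (by linarith) (by positivity)]
      have h3 : 1 ≤ Real.logb 2 l ^ 2 := one_le_pow₀ hlog1
      have h4 : 6 * (Real.exp 1 * Real.sqrt l) ≤ 3 * l := by nlinarith
      nlinarith
    linarith
end

section
/- Let q be a prime number and let d, n be integers with 1 ≤ d < q and 1 ≤ n ≤ q^{d+1}. Then there exists an indexed family G = (g_1, …, g_q) of q functions g_s : [n] → [q] such that: (i) for every pair of distinct indices i, j ∈ [n], the number of s ∈ {1,…,q} with g_s(i) = g_s(j) is at most d; and (ii) for every s ∈ {1,…,q} and every value q' ∈ [q], the preimage size |g_s^{-1}(q')| belongs to {⌊n/q⌋, ⌊n/q⌋ + 1}. -/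
open Polynomial in
/-- The polynomial over `ZMod q` whose coefficients are the `m` lowest base-`q` digits of `i`. -/
noncomputable def digitPolynomial (q m i : ℕ) : (ZMod q)[X] :=
  ∑ k ∈ Finset.range m, C ((i / q ^ k : ℕ) : ZMod q) * X ^ k

theorem coeff_digitPolynomial (q m i k : ℕ) (hk : k < m) :
    (digitPolynomial q m i).coeff k = ((i / q ^ k : ℕ) : ZMod q) := by
  simp [digitPolynomial, Polynomial.finsetSum_coeff, Polynomial.coeff_X_pow, hk]

theorem natDegree_digitPolynomial_le (q d i : ℕ) :
    (digitPolynomial q (d + 1) i).natDegree ≤ d := by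
  refine Polynomial.natDegree_sum_le_of_forall_le _ _ fun k hk => ?_
  exact (Polynomial.natDegree_C_mul_X_pow_le _ _).trans
    (Nat.lt_succ_iff.1 (Finset.mem_range.1 hk))

theorem Nat.eq_of_forall_div_pow_modEq {q : ℕ} (m : ℕ) {i j : ℕ} (hi : i < q ^ m)
    (hj : j < q ^ m) (h : ∀ k < m, i / q ^ k ≡ j / q ^ k [MOD q]) : i = j := by
  induction m generalizing i j with
  | zero => simp at hi hj; omega
  | succ m ih =>
    have hdiv : i / q = j / q := by
      refine ih (Nat.div_lt_of_lt_mul (by rwa [← pow_succ']))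
        (Nat.div_lt_of_lt_mul (by rwa [← pow_succ'])) fun k hk => ?_
      simpa [Nat.div_div_eq_div_mul, ← pow_succ'] using h (k + 1) (by omega)
    have hmod : i % q = j % q := by simpa [Nat.ModEq] using h 0 (by omega)
    rw [← Nat.div_add_mod i q, ← Nat.div_add_mod j q, hdiv, hmod]

theorem digitPolynomial_injOn (q m : ℕ) :
    Set.InjOn (digitPolynomial q m) (Set.Iio (q ^ m)) := by
  intro i hi j hj h
  refine Nat.eq_of_forall_div_pow_modEq m hi hj fun k hk => ?_
  rw [← ZMod.natCast_eq_natCast_iff, ← coeff_digitPolynomial q m i k hk,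
    ← coeff_digitPolynomial q m j k hk, h]

/-- Within a block of `q` consecutive integers the digit polynomials differ only in their
constant terms. -/
theorem eval_digitPolynomial_block (q d a r : ℕ) (hr : r < q) (x : ZMod q) :
    (digitPolynomial q (d + 1) (q * a + r)).eval x =
      (digitPolynomial q (d + 1) (q * a)).eval x + r := by
  have hq : 0 < q := by omega
  simp only [digitPolynomial, Finset.sum_range_succ']
  have h : ∀ k, (q * a + r) / q ^ (k + 1) = q * a / q ^ (k + 1) := fun k => by
    rw [pow_succ', ← Nat.div_div_eq_div_mul, ← Nat.div_div_eq_div_mul,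
      Nat.mul_add_div hq, Nat.div_eq_of_lt hr, Nat.mul_div_cancel_left _ hq, add_zero]
  simp [h, Polynomial.eval_finsetSum]

theorem ZMod.count_natCast_eq (q : ℕ) [NeZero q] (c : ZMod q) :
    Nat.count (fun k => (k : ZMod q) = c) q = 1 := by
  rw [Nat.count_eq_card_filter_range, Finset.card_eq_one]
  refine ⟨c.val, Finset.ext fun k => ?_⟩
  simp only [Finset.mem_filter, Finset.mem_range, Finset.mem_singleton]
  constructor
  · rintro ⟨hk, rfl⟩
    exact (ZMod.val_cast_of_lt hk).symm
  · rintro rfl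
    exact ⟨ZMod.val_lt c, ZMod.natCast_zmod_val c⟩

/-- If `f` runs through a translate of the residues modulo `q` on each block of `q` consecutive
integers, then every value is attained `⌊n/q⌋` or `⌊n/q⌋ + 1` times below `n`. -/
theorem Nat.count_eq_div_or_of_block (q : ℕ) [NeZero q] (f : ℕ → ZMod q)
    (hf : ∀ a r, r < q → f (q * a + r) = f (q * a) + r) (c : ZMod q) (n : ℕ) :
    Nat.count (fun i => f i = c) n = n / q ∨ Nat.count (fun i => f i = c) n = n / q + 1 := by
  have hblock : ∀ a r, r ≤ q → Nat.count (fun k => f (q * a + k) = c) r =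
      Nat.count (fun k => (k : ZMod q) = c - f (q * a)) r := fun a r hr => by
    rw [Nat.count_eq_card_filter_range, Nat.count_eq_card_filter_range]
    congr 1
    refine Finset.filter_congr fun k hk => ?_
    rw [hf a k ((Finset.mem_range.1 hk).trans_le hr), eq_sub_iff_add_eq, add_comm]
  have hfull : ∀ a, Nat.count (fun i => f i = c) (q * a) = a := fun a => by
    induction a with
    | zero => simp
    | succ a ih => rw [mul_add_one, Nat.count_add, ih, hblock a q le_rfl, ZMod.count_natCast_eq]
  have hr : n % q ≤ q := (Nat.mod_lt n (NeZero.pos q)).le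
  have hle := Nat.count_monotone (fun k : ℕ => (k : ZMod q) = c - f (q * (n / q))) hr
  rw [ZMod.count_natCast_eq, ← hblock _ _ hr] at hle
  have hn := Nat.count_add (fun i => f i = c) (q * (n / q)) (n % q)
  rw [Nat.div_add_mod, hfull] at hn
  omega

/-- **Dimension-reduction family from Reed–Solomon codes.**
For a prime `q`, an integer `1 ≤ d < q` and `1 ≤ n ≤ q^(d+1)`, there is a family
`g_1, …, g_q` of functions `[n] → [q]` such that (i) any two distinct points of
`[n]` collide under at most `d` of the functions, and (ii) every preimage
`g_s⁻¹(q')` has size `⌊n/q⌋` or `⌊n/q⌋ + 1`. -/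
theorem exists_dimension_reduction_family
    (q d n : ℕ) (hq : Nat.Prime q) (hd1 : 1 ≤ d) (hdq : d < q)
    (hn1 : 1 ≤ n) (hn : n ≤ q ^ (d + 1)) :
    ∃ g : Fin q → Fin n → Fin q,
      (∀ i j : Fin n, i ≠ j →
        (Finset.univ.filter (fun s : Fin q => g s i = g s j)).card ≤ d) ∧
      (∀ s : Fin q, ∀ q' : Fin q,
        (Finset.univ.filter (fun i : Fin n => g s i = q')).card = n / q ∨
        (Finset.univ.filter (fun i : Fin n => g s i = q')).card = n / q + 1) := by
  have : Fact q.Prime := ⟨hq⟩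
  have : NeZero q := ⟨hq.ne_zero⟩
  let e := ZMod.finEquiv q
  refine ⟨fun s i => e.symm ((digitPolynomial q (d + 1) i).eval (e s)), fun i j hij => ?_,
    fun s c => ?_⟩
  · set p := digitPolynomial q (d + 1) i - digitPolynomial q (d + 1) j with hp
    have hp0 : p ≠ 0 := sub_ne_zero.2 fun h => hij <| Fin.ext <|
      digitPolynomial_injOn q (d + 1) (i.2.trans_le hn) (j.2.trans_le hn) h
    have hdeg : p.natDegree ≤ d := (Polynomial.natDegree_sub_le_of_le
      (natDegree_digitPolynomial_le q d i) (natDegree_digitPolynomial_le q d j)).trans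
        (max_self d).le
    refine le_trans ?_ ((Multiset.toFinset_card_le _).trans ((Polynomial.card_roots' p).trans hdeg))
    refine Finset.card_le_card_of_injOn e (fun s hs => ?_) e.injective.injOn
    have hs' := e.symm.injective (Finset.mem_filter.1 hs).2
    simpa [hp, hs'] using hp0
  · have h := Nat.count_eq_div_or_of_block q
      (fun i => (digitPolynomial q (d + 1) i).eval (e s))
      (fun a r hr => eval_digitPolynomial_block q d a r hr (e s)) (e c) n
    rw [Nat.count_eq_card_filter_range, Finset.card_filter, Finset.sum_range,
      ← Finset.card_filter] at h
    simpa only [RingEquiv.symm_apply_eq] using h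
end

section
/- Let c₀ = 1/2 − 1/(2e). There exist constants C > 0 and n₀ such that for every integer n ≥ n₀: | max_{1 ≤ m ≤ n−1} f(n,m) − (1/e + c₀/n) | ≤ C·n^{−3/2}. Equivalently, the optimal success probability OPT_n of the best wait-and-pick secretary algorithm on n items under a uniformly random arrival order satisfies OPT_n = 1/e + c₀/n + Θ(n^{−3/2}). -/
/-- The `j`-th harmonic number `H_j = Σ_{i=1}^j 1/i` (with `H_0 = 0`). -/
noncomputable def harm (j : ℕ) : ℝ := ∑ i ∈ Finset.range j, (1 : ℝ) / (i + 1)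

/-- `f(n,m) = (m/n)·(H_{n−1} − H_{m−1})`, the success probability of the
wait-and-pick secretary algorithm with checkpoint `m` on `n` items. -/
noncomputable def f (n m : ℕ) : ℝ := ((m : ℝ) / n) * (harm (n - 1) - harm (m - 1))

open Real

/-- Stepwise error of the trapezoidal approximation of `log` by harmonic numbers. -/
lemma abs_trapezoid_sub_log_le (k : ℕ) (hk : 1 ≤ k) :
    |1 / (2 * (k : ℝ)) + 1 / (2 * ((k : ℝ) + 1)) - (log ((k : ℝ) + 1) - log k)| ≤
      1 / (k : ℝ) ^ 2 - 1 / ((k : ℝ) + 1) ^ 2 := by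
  have hk0 : (0 : ℝ) < k := by exact_mod_cast hk
  set t : ℝ := 1 / ((k : ℝ) + 1) with ht
  have ht0 : 0 < t := by positivity
  have ht1 : t < 1 := by rw [ht, div_lt_one (by positivity)]; linarith
  have h := abs_log_sub_add_sum_range_le (x := t) (by rwa [abs_of_pos ht0]) 2
  have hlog : log (1 - t) = log k - log ((k : ℝ) + 1) := by
    rw [← log_div hk0.ne' (by positivity)]
    congr 1
    rw [ht]
    field_simp
    ring
  rw [abs_of_pos ht0, hlog] at h
  simp only [Finset.sum_range_succ, Finset.sum_range_zero] at h
  norm_num at h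
  have hr : t ^ 3 / (1 - t) = 1 / (((k : ℝ) + 1) ^ 2 * k) := by
    have : 1 - t = k / ((k : ℝ) + 1) := by rw [ht]; field_simp; ring
    rw [this, ht]
    field_simp
  have hs : 1 / (2 * (k : ℝ)) + 1 / (2 * ((k : ℝ) + 1)) =
      t + t ^ 2 / 2 + 1 / (((k : ℝ) + 1) ^ 2 * k) / 2 := by
    rw [ht]
    field_simp
    ring
  have hb : 3 / 2 * (1 / (((k : ℝ) + 1) ^ 2 * k)) ≤
      1 / (k : ℝ) ^ 2 - 1 / ((k : ℝ) + 1) ^ 2 := by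
    have h1 : 1 / (k : ℝ) ^ 2 - 1 / ((k : ℝ) + 1) ^ 2 - 3 / 2 * (1 / (((k : ℝ) + 1) ^ 2 * k)) =
        (k / 2 + 1) / (((k : ℝ) + 1) ^ 2 * k ^ 2) := by
      field_simp
      ring
    have h2 : 0 ≤ (k / 2 + 1) / (((k : ℝ) + 1) ^ 2 * (k : ℝ) ^ 2) := by positivity
    linarith
  have hp : 0 < 1 / (((k : ℝ) + 1) ^ 2 * k) := by positivity
  rw [hr] at h
  rw [abs_le] at h ⊢
  rw [hs]
  constructor <;> linarith [h.1, h.2]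

lemma abs_harm_sub_log_le (m n : ℕ) (hm : 1 ≤ m) (hmn : m ≤ n) :
    |(harm (n - 1) + 1 / (2 * (n : ℝ)) - log n) - (harm (m - 1) + 1 / (2 * (m : ℝ)) - log m)| ≤
      1 / (m : ℝ) ^ 2 - 1 / (n : ℝ) ^ 2 := by
  induction n, hmn using Nat.le_induction with
  | base => simp
  | succ k hk ih =>
    have hk1 : 1 ≤ k := hm.trans hk
    have hk0 : (0 : ℝ) < k := by exact_mod_cast hk1
    have h := abs_trapezoid_sub_log_le k hk1
    have hh : harm (k + 1 - 1) = harm (k - 1) + 1 / (k : ℝ) := by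
      obtain ⟨j, rfl⟩ := Nat.exists_eq_add_of_le' hk1
      simp [harm, Finset.sum_range_succ]
    have h2 : 1 / (k : ℝ) = 1 / (2 * (k : ℝ)) + 1 / (2 * (k : ℝ)) := by
      field_simp
      norm_num
    rw [hh, h2]
    push_cast
    rw [abs_le] at ih h ⊢
    constructor <;> linarith [ih.1, ih.2, h.1, h.2]

lemma abs_f_sub_le (m n : ℕ) (hm : 1 ≤ m) (hmn : m ≤ n) :
    |f n m - (negMulLog ((m : ℝ) / n) + (1 - (m : ℝ) / n) / (2 * n))| ≤ 1 / ((n : ℝ) * m) := by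
  have hm0 : (0 : ℝ) < m := by exact_mod_cast hm
  have hn0 : (0 : ℝ) < n := by exact_mod_cast hm.trans hmn
  have h := abs_harm_sub_log_le m n hm hmn
  have he : f n m - (negMulLog ((m : ℝ) / n) + (1 - (m : ℝ) / n) / (2 * n)) =
      (m : ℝ) / n * ((harm (n - 1) + 1 / (2 * (n : ℝ)) - log n) -
        (harm (m - 1) + 1 / (2 * (m : ℝ)) - log m)) := by
    rw [f, negMulLog, log_div hm0.ne' hn0.ne']
    field_simp
    ring
  rw [he, abs_mul, abs_of_pos (by positivity : (0 : ℝ) < (m : ℝ) / n)]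
  have h2 : 0 < 1 / (n : ℝ) ^ 2 := by positivity
  calc _ ≤ (m : ℝ) / n * (1 / (m : ℝ) ^ 2) := by gcongr; linarith
    _ = _ := by field_simp

lemma negMulLog_le_exp_neg_one_sub_sq (x : ℝ) (hx0 : 0 < x) (hx1 : x ≤ 1) :
    negMulLog x ≤ exp (-1) - 2 / 9 * (x - exp (-1)) ^ 2 := by
  set s := √(exp 1 * x) with hs
  have hs0 : 0 < s := sqrt_pos.mpr (by positivity)
  have hsq : s ^ 2 = exp 1 * x := sq_sqrt (by positivity)
  have he : exp 1 * exp (-1) = 1 := by rw [← exp_add]; simp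
  have he1 := exp_one_gt_d9
  have he2 := exp_one_lt_d9
  have ha : 0 < exp (-1) := exp_pos _
  have hs2 : s < 2 := by nlinarith
  have hx : x = exp (-1) * s ^ 2 := by rw [hsq]; linear_combination (-x) * he
  have hlog : log x = 2 * log s - 1 := by
    rw [hx, log_mul ha.ne' (by positivity), log_exp, log_pow]
    push_cast
    ring
  have hls : s - 1 ≤ s * log s := by
    have := mul_le_mul_of_nonneg_left (one_sub_inv_le_log_of_pos hs0) hs0.le
    rwa [mul_sub, mul_inv_cancel₀ hs0.ne', mul_one] at this
  rw [negMulLog, hlog, hx]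
  have h1 : -(exp (-1) * s ^ 2) * (2 * log s - 1) ≤ exp (-1) - exp (-1) * (s - 1) ^ 2 := by
    nlinarith [mul_le_mul_of_nonneg_left hls (mul_pos ha hs0).le]
  have h2 : 2 / 9 * (exp (-1) * s ^ 2 - exp (-1)) ^ 2 ≤ exp (-1) * (s - 1) ^ 2 := by
    have h3 : exp (-1) ≤ 1 / 2 := by nlinarith
    have h4 : (s + 1) ^ 2 ≤ 9 := by nlinarith
    have h5 : 2 / 9 * (exp (-1) * (s + 1) ^ 2) ≤ 1 := by nlinarith
    nlinarith [mul_le_mul_of_nonneg_left h5 (by positivity : 0 ≤ exp (-1) * (s - 1) ^ 2)]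
  linarith

lemma exp_neg_one_sub_sq_le_negMulLog (x : ℝ) (hx : 0 < x) :
    exp (-1) - exp 1 * (x - exp (-1)) ^ 2 ≤ negMulLog x := by
  have he : exp 1 * exp (-1) = 1 := by rw [← exp_add]; simp
  have h := log_le_sub_one_of_pos (mul_pos (exp_pos 1) hx)
  rw [log_mul (exp_pos 1).ne' hx.ne', log_exp] at h
  have h1 : exp 1 * (x - exp (-1)) ^ 2 = exp 1 * x ^ 2 - 2 * x + exp (-1) := by
    linear_combination (exp (-1) - 2 * x) * he
  rw [negMulLog, h1]
  nlinarith [mul_le_mul_of_nonneg_left h hx.le]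

lemma f_le_optimum (m n : ℕ) (hn : 144 ≤ n) (hm : 1 ≤ m) (hmn : m ≤ n) :
    f n m ≤ exp (-1) + (1 / 2 - exp (-1) / 2) / n + 11 / (n : ℝ) ^ 2 := by
  have hm0 : (1 : ℝ) ≤ m := by exact_mod_cast hm
  have hn0 : (144 : ℝ) ≤ n := by exact_mod_cast hn
  have hmn' : (m : ℝ) ≤ n := by exact_mod_cast hmn
  have h := (abs_le.mp (abs_f_sub_le m n hm hmn)).2
  have hx1 : (m : ℝ) / n ≤ 1 := by rw [div_le_one (by linarith)]; exact hmn'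
  have hx0 : 0 < (m : ℝ) / n := by positivity
  have hneg := negMulLog_le_exp_neg_one_sub_sq _ hx0 hx1
  set x := (m : ℝ) / n with hx
  set d := x - exp (-1) with hd
  have hlin : (1 - x) / (2 * n) = (1 / 2 - exp (-1) / 2) / n - d / 2 * (1 / n) := by
    rw [hd]
    field_simp
    ring
  have hq : -(d / 2 * (1 / n)) ≤ 1 / 9 * d ^ 2 + 9 / 16 * (1 / (n : ℝ)) ^ 2 := by
    nlinarith [sq_nonneg (d / 3 + 3 / 4 * (1 / (n : ℝ)))]
  have herr : 1 / ((n : ℝ) * m) ≤ 1 / 9 * d ^ 2 + 10 * (1 / (n : ℝ)) ^ 2 := by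
    rcases le_total (1 / 10) x with h10 | h10
    · have h1 : 1 / ((n : ℝ) * m) ≤ 10 * (1 / (n : ℝ)) ^ 2 := by
        rw [hx, le_div_iff₀ (by linarith)] at h10
        rw [one_div_pow, mul_one_div, div_le_div_iff₀ (by positivity) (by positivity)]
        nlinarith
      nlinarith [sq_nonneg d]
    · have he : exp 1 * exp (-1) = 1 := by rw [← exp_add]; simp
      have ha : 0.36 ≤ exp (-1) := by nlinarith [exp_one_lt_d9, exp_pos (-1)]
      have h1 : 1 / ((n : ℝ) * m) ≤ 1 / 144 := by
        apply one_div_le_one_div_of_le (by norm_num)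
        nlinarith
      have h2 : 1 / 16 ≤ d ^ 2 := by nlinarith
      nlinarith [sq_nonneg (1 / (n : ℝ))]
  have h11 : 11 / (n : ℝ) ^ 2 = 11 * (1 / (n : ℝ)) ^ 2 := by rw [one_div_pow]; ring
  rw [h11]
  nlinarith [sq_nonneg (1 / (n : ℝ))]

lemma exists_optimum_le_f (n : ℕ) (hn : 144 ≤ n) :
    ∃ m ∈ Finset.Icc 1 (n - 1),
      exp (-1) + (1 / 2 - exp (-1) / 2) / n - 11 / (n : ℝ) ^ 2 ≤ f n m := by
  have hn0 : (144 : ℝ) ≤ n := by exact_mod_cast hn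
  have ha : 0 < exp (-1) := exp_pos _
  have he : exp 1 * exp (-1) = 1 := by rw [← exp_add]; simp
  have he1 := exp_one_gt_d9
  have he2 := exp_one_lt_d9
  have ha2 : exp (-1) ≤ 1 / 2 := by nlinarith
  have hna : 0 < (n : ℝ) * exp (-1) := by positivity
  set m := ⌈(n : ℝ) * exp (-1)⌉₊ with hm
  have hm1 : 1 ≤ m := Nat.ceil_pos.mpr hna
  have hle : (n : ℝ) * exp (-1) ≤ m := Nat.le_ceil _
  have hlt : (m : ℝ) < n * exp (-1) + 1 := Nat.ceil_lt_add_one hna.le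
  have hmn : m + 1 ≤ n := by
    have : (m : ℝ) + 1 ≤ n := by nlinarith
    exact_mod_cast this
  refine ⟨m, Finset.mem_Icc.mpr ⟨hm1, by omega⟩, ?_⟩
  have hm0 : (1 : ℝ) ≤ m := by exact_mod_cast hm1
  have h := (abs_le.mp (abs_f_sub_le m n hm1 (by omega))).1
  have hneg := exp_neg_one_sub_sq_le_negMulLog ((m : ℝ) / n) (by positivity)
  set x := (m : ℝ) / n with hx
  set d := x - exp (-1) with hd
  set u := 1 / (n : ℝ) with hu
  have hu0 : 0 < u := by positivity
  have hd0 : 0 ≤ d := by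
    rw [hd, sub_nonneg, hx, le_div_iff₀ (by linarith)]
    linarith
  have hdu : d ≤ u := by
    have : d = (m - n * exp (-1)) * u := by
      rw [hd, hx, hu]
      field_simp
    rw [this]
    nlinarith
  have hlin : (1 - x) / (2 * n) = (1 / 2 - exp (-1) / 2) / n - d / 2 * u := by
    rw [hd, hu]
    field_simp
    ring
  have herr : 1 / ((n : ℝ) * m) ≤ 3 * u ^ 2 := by
    rw [hu, one_div_pow, mul_one_div, div_le_div_iff₀ (by positivity) (by positivity)]
    have : (n : ℝ) ≤ 3 * m := by nlinarith
    nlinarith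
  have h11 : 11 / (n : ℝ) ^ 2 = 11 * u ^ 2 := by rw [hu, one_div_pow]; ring
  have hdd : d ^ 2 ≤ u ^ 2 := by gcongr
  have hed : exp 1 * d ^ 2 ≤ 3 * u ^ 2 := by nlinarith [sq_nonneg d]
  rw [h11]
  nlinarith

/-- **Asymptotics of the optimal secretary success probability.**
With `c₀ = 1/2 − 1/(2e)`, the optimal success probability
`OPT_n = max_{1 ≤ m ≤ n−1} f(n,m)` satisfies
`OPT_n = 1/e + c₀/n + Θ(n^{−3/2})`. -/
theorem optimum_expansion :
    ∃ C : ℝ, 0 < C ∧ ∃ n₀ : ℕ, ∀ n : ℕ, n₀ ≤ n → ∀ _hn : 2 ≤ n,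
      |(Finset.Icc 1 (n - 1)).sup' (Finset.nonempty_Icc.mpr (by omega)) (f n) -
          (1 / Real.exp 1 + (1 / 2 - 1 / (2 * Real.exp 1)) / n)| ≤
        C * (n : ℝ) ^ (-(3 : ℝ) / 2) := by
  refine ⟨11, by norm_num, 144, fun n hn _ => ?_⟩
  have hn1 : (1 : ℝ) ≤ n := by exact_mod_cast (by omega : 1 ≤ n)
  have hpow : 11 / (n : ℝ) ^ 2 ≤ 11 * (n : ℝ) ^ (-(3 : ℝ) / 2) := by
    rw [div_eq_mul_inv, ← rpow_natCast, ← rpow_neg (by linarith)]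
    gcongr
    norm_num
  have hc : 1 / exp 1 + (1 / 2 - 1 / (2 * exp 1)) / n =
      exp (-1) + (1 / 2 - exp (-1) / 2) / n := by
    rw [exp_neg]
    field_simp
  rw [hc]
  refine le_trans (abs_le.mpr ⟨?_, ?_⟩) hpow
  · obtain ⟨m, hm, hfm⟩ := exists_optimum_le_f n hn
    have := Finset.le_sup' (f n) hm
    linarith
  · rw [sub_le_iff_le_add']
    refine Finset.sup'_le _ _ fun m hm => ?_
    rw [Finset.mem_Icc] at hm
    exact f_le_optimum m n hn hm.1 (by omega)
end

section
/- Let n ≥ 2, let m ∈ {1,…,n−1} be a checkpoint, and let p be any probability distribution on the set Π_n of permutations of [n]. Then there exists an injective value assignment A : [n] → ℝ (an adversarial ordering of n distinct values) such that the wait-and-pick algorithm with checkpoint m, run on the observed sequence w_t = A(π(t)) with π drawn from p, selects the maximum value with probability at most f(n,m) = (m/n)·(H_{n−1} − H_{m−1}). -/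
open scoped Classical

open Finset in
/-- If `P` is stable under permuting the positions in `S`, then the maximum of `σ` over `S` is
equally likely to be attained at each position of `S`, conditionally on `P`. -/
theorem card_mul_card_argmax {n : ℕ} (S : Finset (Fin n)) (P : Equiv.Perm (Fin n) → Prop)
    (hP : ∀ s ∈ S, ∀ s' ∈ S, ∀ σ, P σ → P (σ * Equiv.swap s s')) {s : Fin n} (hs : s ∈ S) :
    #S * #{σ : Equiv.Perm (Fin n) | P σ ∧ ∀ r ∈ S, σ r ≤ σ s} =
      #{σ : Equiv.Perm (Fin n) | P σ} := by
  have hle : ∀ a ∈ S, ∀ b ∈ S,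
      #{σ : Equiv.Perm (Fin n) | P σ ∧ ∀ r ∈ S, σ r ≤ σ a} ≤
        #{σ : Equiv.Perm (Fin n) | P σ ∧ ∀ r ∈ S, σ r ≤ σ b} := by
    intro a ha b hb
    refine card_le_card_of_injOn (fun σ => σ * Equiv.swap a b) ?_ (mul_left_injective _).injOn
    intro σ hσ
    simp only [coe_filter, mem_univ, true_and, Set.mem_ofPred_eq] at hσ ⊢
    refine ⟨hP a ha b hb σ hσ.1, fun r hr => ?_⟩
    rw [Equiv.Perm.mul_apply, Equiv.Perm.mul_apply, Equiv.swap_apply_right]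
    apply hσ.2
    rw [Equiv.swap_apply_def]
    split_ifs <;> assumption
  have hunion : ({σ : Equiv.Perm (Fin n) | P σ} : Finset _) =
      S.biUnion fun a => {σ : Equiv.Perm (Fin n) | P σ ∧ ∀ r ∈ S, σ r ≤ σ a} := by
    ext σ
    simp only [mem_filter, mem_univ, true_and, mem_biUnion]
    refine ⟨fun h => ?_, fun ⟨_, _, h, _⟩ => h⟩
    obtain ⟨a, ha, hmax⟩ := exists_max_image S σ ⟨s, hs⟩
    exact ⟨a, ha, h, hmax⟩
  rw [hunion, card_biUnion, sum_congr rfl fun a ha => (hle a ha s hs).antisymm (hle s hs a ha),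
    sum_const, smul_eq_mul]
  intro a ha b hb hab
  rw [Function.onFun, disjoint_left]
  intro σ hσa hσb
  simp only [mem_filter, mem_univ, true_and] at hσa hσb
  exact hab (σ.injective ((hσb.2 a ha).antisymm (hσa.2 b hb)))

open Finset in
/-- The number of permutations whose maximum is at `t` and whose maximum among the positions
before `t` is at `s`. -/
theorem card_max_and_prefix_max {n : ℕ} {s t : Fin n} (hst : s < t) :
    (#{σ : Equiv.Perm (Fin n) | (∀ r, σ r ≤ σ t) ∧ ∀ r ∈ Iio t, σ r ≤ σ s} : ℝ) =
      n.factorial / n * (1 / (t : ℕ)) := by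
  have h1 : #(Iio t) *
      #{σ : Equiv.Perm (Fin n) | (∀ r, σ r ≤ σ t) ∧ ∀ r ∈ Iio t, σ r ≤ σ s} =
        #{σ : Equiv.Perm (Fin n) | ∀ r, σ r ≤ σ t} := by
    have h := card_mul_card_argmax (Iio t) (fun σ => ∀ r, σ r ≤ σ t) (fun a ha b hb σ h r => by
      have hta : t ≠ a := (mem_Iio.1 ha).ne'
      have htb : t ≠ b := (mem_Iio.1 hb).ne'
      rw [Equiv.Perm.mul_apply, Equiv.Perm.mul_apply, Equiv.swap_apply_of_ne_of_ne hta htb]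
      exact h _) (mem_Iio.2 hst)
    convert h
  have h2 : n * #{σ : Equiv.Perm (Fin n) | ∀ r, σ r ≤ σ t} = n.factorial := by
    have h := card_mul_card_argmax univ (fun _ : Equiv.Perm (Fin n) => True)
      (fun _ _ _ _ _ _ => trivial) (mem_univ t)
    simp only [mem_univ, true_and, forall_const, filter_true, card_univ, Fintype.card_perm,
      Fintype.card_fin] at h
    convert h
  rw [← h1, Fin.card_Iio] at h2
  have hn : (n : ℝ) ≠ 0 := by
    have := t.pos
    positivity
  have ht : ((t : ℕ) : ℝ) ≠ 0 := by
    have : 0 < (t : ℕ) := (Nat.zero_le _).trans_lt hst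
    positivity
  rw [← h2]
  push_cast
  field_simp

/-- When wait-and-pick succeeds, the maximum occurs at some `t ≥ m`, and the maximum among the
positions before `t` occurs before the checkpoint. -/
theorem exists_of_wpSucceeds {n m : ℕ} (hm1 : 1 ≤ m) (hm2 : m ≤ n - 1) {w : Fin n → ℝ}
    (hw : Function.Injective w) (h : wpSucceeds m w) :
    ∃ t s : Fin n, m ≤ (t : ℕ) ∧ (s : ℕ) < m ∧ (∀ r, w r ≤ w t) ∧
      ∀ r ∈ Finset.Iio t, w r ≤ w s := by
  unfold wpSucceeds at h
  split_ifs at h with hne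
  · have hmem := Finset.min'_mem _ hne
    have hmin := fun x hx => Finset.min'_le (wpCand m w) x hx
    set t := (wpCand m w).min' hne
    simp only [wpCand, Finset.mem_filter, Finset.mem_univ, true_and] at hmem hmin
    obtain ⟨s, hs, hmax⟩ := Finset.exists_max_image (Finset.Iio t) w
      ⟨⟨0, by omega⟩, Finset.mem_Iio.2 (Fin.lt_def.2 (by simp only; omega))⟩
    refine ⟨t, s, hmem.1, ?_, h, hmax⟩
    by_contra! hsm
    have hst := Finset.mem_Iio.1 hs
    refine absurd (hmin s ⟨hsm, fun r hr => ?_⟩) (not_le.2 hst)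
    have hrs : r < s := Fin.lt_def.2 (by omega)
    exact (hmax r (Finset.mem_Iio.2 (hrs.trans hst))).lt_of_ne (hw.ne hrs.ne)
  · refine absurd ⟨⟨n - 1, by omega⟩, ?_⟩ hne
    simp only [wpCand, Finset.mem_filter, Finset.mem_univ, true_and]
    refine ⟨hm2, fun s hs => (h s _ rfl).lt_of_ne (hw.ne ?_)⟩
    rintro rfl
    simp only at hs
    omega

theorem harm_sub_harm {n m : ℕ} (hm1 : 1 ≤ m) (hm2 : m ≤ n - 1) :
    harm (n - 1) - harm (m - 1) =
      ∑ t ∈ Finset.univ.filter (fun t : Fin n => m ≤ (t : ℕ)), (1 : ℝ) / (t : ℕ) := by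
  have hharm : ∀ k, 1 ≤ k → harm (k - 1) = ∑ i ∈ Finset.range k, (1 : ℝ) / i := by
    intro k hk
    obtain ⟨j, rfl⟩ := Nat.exists_eq_add_of_le' hk
    simp [harm, Finset.sum_range_succ']
  rw [hharm n (by omega), hharm m hm1, ← Finset.sum_Ico_eq_sub _ (by omega), Finset.sum_filter,
    Fin.sum_univ_eq_sum_range (fun i => if m ≤ i then (1 : ℝ) / i else 0) n, ← Finset.sum_filter]
  congr 1
  ext i
  simp [and_comm]

open Finset in
/-- Wait-and-pick succeeds on at most a fraction `f(n,m)` of all rankings. -/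
theorem card_wpSucceeds_le {n m : ℕ} (hm1 : 1 ≤ m) (hm2 : m ≤ n - 1) :
    (#{σ : Equiv.Perm (Fin n) | wpSucceeds m (fun t => ((σ t : ℕ) : ℝ))} : ℝ) ≤
      n.factorial * ((m : ℝ) / n * (harm (n - 1) - harm (m - 1))) := by
  have hsub : ({σ : Equiv.Perm (Fin n) | wpSucceeds m (fun t => ((σ t : ℕ) : ℝ))} : Finset _) ⊆
      ({t : Fin n | m ≤ (t : ℕ)} : Finset _).biUnion fun t =>
        ({s : Fin n | (s : ℕ) < m} : Finset _).biUnion fun s =>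
          {σ : Equiv.Perm (Fin n) | (∀ r, σ r ≤ σ t) ∧ ∀ r ∈ Iio t, σ r ≤ σ s} := by
    intro σ hσ
    have hinj : Function.Injective fun t : Fin n => ((σ t : ℕ) : ℝ) :=
      Nat.cast_injective.comp (Fin.val_injective.comp σ.injective)
    obtain ⟨t, s, ht, hs, h1, h2⟩ := exists_of_wpSucceeds hm1 hm2 hinj (mem_filter.1 hσ).2
    simp only [Nat.cast_le, Fin.val_fin_le] at h1 h2
    simp only [mem_biUnion, mem_filter, mem_univ, true_and]
    exact ⟨t, ht, s, hs, h1, h2⟩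
  have hcard : #{s : Fin n | (s : ℕ) < m} = m := by
    rw [Fin.card_filter_val_lt]
    omega
  calc (#{σ : Equiv.Perm (Fin n) | wpSucceeds m (fun t => ((σ t : ℕ) : ℝ))} : ℝ)
      ≤ ∑ t ∈ Finset.univ.filter (fun t : Fin n => m ≤ (t : ℕ)),
          ∑ s ∈ univ.filter (fun s : Fin n => (s : ℕ) < m),
          (#{σ : Equiv.Perm (Fin n) | (∀ r, σ r ≤ σ t) ∧ ∀ r ∈ Iio t, σ r ≤ σ s} : ℝ) := by
        exact_mod_cast (card_le_card hsub).trans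
          (card_biUnion_le.trans (sum_le_sum fun t _ => card_biUnion_le))
    _ = ∑ t ∈ Finset.univ.filter (fun t : Fin n => m ≤ (t : ℕ)),
          ∑ s ∈ univ.filter (fun s : Fin n => (s : ℕ) < m),
          (n.factorial / n * (1 / (t : ℕ)) : ℝ) := by
        refine sum_congr rfl fun t ht => sum_congr rfl fun s hs => card_max_and_prefix_max ?_
        exact Fin.lt_def.2 ((mem_filter.1 hs).2.trans_le (mem_filter.1 ht).2)
    _ = n.factorial * ((m : ℝ) / n * (harm (n - 1) - harm (m - 1))) := by
        simp only [sum_const, hcard, nsmul_eq_mul]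
        rw [harm_sub_harm hm1 hm2, ← mul_sum, ← mul_sum]
        ring

/-- **Adversarial upper bound for wait-and-pick under an arbitrary
distribution on arrival orders.**  For every probability distribution `p` on
the permutations of `[n]` there is an injective value assignment `A` such that
the wait-and-pick algorithm with checkpoint `m`, run on the observed sequence
`t ↦ A(π(t))` with `π ∼ p`, selects the maximum value with probability at most
`f(n,m) = (m/n)·(H_{n−1} − H_{m−1})`. -/
theorem wait_and_pick_adversarial_bound
    (n m : ℕ) (hn : 2 ≤ n) (hm1 : 1 ≤ m) (hm2 : m ≤ n - 1)
    (p : Equiv.Perm (Fin n) → ℝ) (hp : ∀ π, 0 ≤ p π)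
    (hsum : ∑ π : Equiv.Perm (Fin n), p π = 1) :
    ∃ A : Fin n → ℝ, Function.Injective A ∧
      ∑ π : Equiv.Perm (Fin n),
          p π * (if wpSucceeds m (fun t => A (π t)) then (1 : ℝ) else 0)
        ≤ ((m : ℝ) / n) * (harm (n - 1) - harm (m - 1)) := by
  have hinj (σ : Equiv.Perm (Fin n)) : Function.Injective fun i : Fin n => ((σ i : ℕ) : ℝ) :=
    Nat.cast_injective.comp (Fin.val_injective.comp σ.injective)
  suffices h : ∃ σ ∈ (Finset.univ : Finset (Equiv.Perm (Fin n))),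
      ∑ π : Equiv.Perm (Fin n),
          p π * (if wpSucceeds m (fun t => ((σ (π t) : ℕ) : ℝ)) then (1 : ℝ) else 0)
        ≤ ((m : ℝ) / n) * (harm (n - 1) - harm (m - 1)) by
    obtain ⟨σ, -, hσ⟩ := h
    exact ⟨_, hinj σ, hσ⟩
  refine Finset.exists_le_of_sum_le Finset.univ_nonempty ?_
  rw [Finset.sum_comm, Finset.sum_const, Finset.card_univ, Fintype.card_perm, Fintype.card_fin,
    nsmul_eq_mul]
  have hcount (π : Equiv.Perm (Fin n)) :
      ∑ σ : Equiv.Perm (Fin n),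
          (if wpSucceeds m (fun t => ((σ (π t) : ℕ) : ℝ)) then (1 : ℝ) else 0)
        ≤ n.factorial * ((m : ℝ) / n * (harm (n - 1) - harm (m - 1))) := by
    refine le_of_eq_of_le ?_ (card_wpSucceeds_le hm1 hm2)
    rw [← Finset.sum_boole]
    exact Fintype.sum_equiv (Equiv.mulRight π) _ _ fun σ => rfl
  calc _ = ∑ π, p π * ∑ σ : Equiv.Perm (Fin n),
          (if wpSucceeds m (fun t => ((σ (π t) : ℕ) : ℝ)) then (1 : ℝ) else 0) := by
        simp only [Finset.mul_sum]
    _ ≤ ∑ π, p π * (n.factorial * ((m : ℝ) / n * (harm (n - 1) - harm (m - 1)))) :=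
        Finset.sum_le_sum fun π _ => mul_le_mul_of_nonneg_left (hcount π) (hp π)
    _ = _ := by rw [← Finset.sum_mul, hsum, one_mul]
end

section
/- Let n ≥ 2, let m ∈ {1,…,n−1}, and let v : [n] → ℝ be injective. If the arrival order π is drawn uniformly at random from the set Π_n of all permutations of [n] and the observed sequence is w_t = v(π(t)), then the probability that the wait-and-pick algorithm with checkpoint m selects the item of maximum value equals f(n,m) = (m/n)·(H_{n−1} − H_{m−1}). -/
open scoped Classical

/-- If a property of permutations is invariant under transposing arguments from `S`, then the
position in `S` at which `v ∘ π` is maximal is equidistributed over `S` given that property. -/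
theorem card_mul_card_filter_max_at {n : ℕ} (v : Fin n → ℝ) (hv : Function.Injective v)
    (S : Finset (Fin n)) (P : Equiv.Perm (Fin n) → Prop)
    (hP : ∀ π, ∀ a ∈ S, ∀ b ∈ S, P π → P (π * Equiv.swap a b)) (s : Fin n) (hs : s ∈ S) :
    S.card * (Finset.univ.filter (fun π : Equiv.Perm (Fin n) =>
        P π ∧ ∀ r ∈ S, v (π r) ≤ v (π s))).card
      = (Finset.univ.filter (fun π : Equiv.Perm (Fin n) => P π)).card := by
  have hU : Finset.univ.filter (fun π : Equiv.Perm (Fin n) => P π)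
      = S.biUnion (fun a => Finset.univ.filter (fun π : Equiv.Perm (Fin n) =>
        P π ∧ ∀ r ∈ S, v (π r) ≤ v (π a))) := by
    ext π
    simp only [Finset.mem_filter, Finset.mem_univ, true_and, Finset.mem_biUnion]
    constructor
    · intro h
      obtain ⟨a, ha, hmax⟩ := S.exists_max_image (fun r => v (π r)) ⟨s, hs⟩
      exact ⟨a, ha, h, hmax⟩
    · rintro ⟨a, _, h, _⟩
      exact h
  have hle : ∀ a ∈ S, ∀ b ∈ S,
      (Finset.univ.filter (fun π : Equiv.Perm (Fin n) =>
        P π ∧ ∀ r ∈ S, v (π r) ≤ v (π a))).card ≤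
      (Finset.univ.filter (fun π : Equiv.Perm (Fin n) =>
        P π ∧ ∀ r ∈ S, v (π r) ≤ v (π b))).card := by
    intro a ha b hb
    refine Finset.card_le_card_of_injOn (fun π => π * Equiv.swap a b) ?_
      (fun π _ ρ _ h => mul_right_cancel h)
    intro π hπ
    simp only [Finset.coe_filter, Finset.mem_univ, true_and, Set.mem_ofPred_eq] at hπ ⊢
    refine ⟨hP π a ha b hb hπ.1, fun r hr => ?_⟩
    simp only [Equiv.Perm.mul_apply, Equiv.swap_apply_right]
    apply hπ.2
    rw [Equiv.swap_apply_def]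
    split_ifs <;> assumption
  rw [hU, Finset.card_biUnion, Finset.sum_congr rfl
    (fun a ha => le_antisymm (hle a ha s hs) (hle s hs a ha)), Finset.sum_const, smul_eq_mul]
  intro a ha b hb hab
  rw [Function.onFun, Finset.disjoint_left]
  intro π h1 h2
  simp only [Finset.mem_filter, Finset.mem_univ, true_and] at h1 h2
  exact hab (π.injective (hv (le_antisymm (h2.2 a ha) (h1.2 b hb))))

/-- On an injective sequence, wait-and-pick succeeds iff the overall maximum comes after the
checkpoint and the best value preceding it comes before the checkpoint. -/
theorem wpSucceeds_iff {n m : ℕ} (hm1 : 1 ≤ m) (hm2 : m < n) (w : Fin n → ℝ)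
    (hw : Function.Injective w) :
    wpSucceeds m w ↔ ∃ t s : Fin n, m ≤ (t : ℕ) ∧ (s : ℕ) < m ∧
      (∀ r, w r ≤ w t) ∧ ∀ r, r < t → w r ≤ w s := by
  have hprefix : ∃ s : Fin n, (s : ℕ) < m ∧ ∀ r : Fin n, (r : ℕ) < m → w r ≤ w s := by
    obtain ⟨s, hs, hmax⟩ := (Finset.univ.filter (fun r : Fin n => (r : ℕ) < m)).exists_max_image w
      ⟨⟨0, by omega⟩, by simpa using (by omega : 0 < m)⟩
    exact ⟨s, by simpa using hs, fun r hr => hmax r (by simpa using hr)⟩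
  obtain ⟨s, hs, hsmax⟩ := hprefix
  unfold wpSucceeds
  split_ifs with h
  · have hmem := (wpCand m w).min'_mem h
    have hmin : ∀ r ∈ wpCand m w, (wpCand m w).min' h ≤ r := fun r => (wpCand m w).min'_le r
    generalize (wpCand m w).min' h = t at hmem hmin ⊢
    simp only [wpCand, Finset.mem_filter, Finset.mem_univ, true_and] at hmem hmin
    constructor
    · intro hmax
      refine ⟨t, s, hmem.1, hs, hmax, fun r hr => ?_⟩
      by_cases hrm : (r : ℕ) < m
      · exact hsmax r hrm
      · by_contra hlt
        exact absurd (hmin r ⟨by omega, fun q hq => (hsmax q hq).trans_lt (not_le.mp hlt)⟩)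
          (not_le.mpr hr)
    · rintro ⟨t', s', ht', hs', hmax, hs'max⟩
      have hcand : t ≤ t' := hmin t' ⟨ht', fun q hq => lt_of_le_of_ne (hmax q)
        (fun e => by have := hw e; subst this; omega)⟩
      rcases hcand.eq_or_lt with rfl | hlt
      · exact hmax
      · exact absurd (hs'max t hlt) (not_le.mpr (hmem.2 s' hs'))
  · constructor
    · intro hlast
      refine absurd ⟨⟨n - 1, by omega⟩, ?_⟩ h
      simp only [wpCand, Finset.mem_filter, Finset.mem_univ, true_and]
      refine ⟨by omega, fun q hq => lt_of_le_of_ne (hlast q _ rfl) (fun e => ?_)⟩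
      have := congrArg Fin.val (hw e)
      simp only at this
      omega
    · rintro ⟨t, s', ht, hs', hmax, -⟩
      refine absurd ⟨t, ?_⟩ h
      simp only [wpCand, Finset.mem_filter, Finset.mem_univ, true_and]
      exact ⟨ht, fun q hq => lt_of_le_of_ne (hmax q)
        (fun e => by have := hw e; subst this; omega)⟩

theorem sum_range_ite_eq_harm_sub (j k : ℕ) :
    ∑ t ∈ Finset.range (j + 1 + k), (if j + 1 ≤ t then (1 : ℝ) / t else 0)
      = harm (j + k) - harm j := by
  induction k with
  | zero =>
    simp only [add_zero, sub_self]
    refine Finset.sum_eq_zero fun t ht => if_neg ?_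
    simpa using ht
  | succ k ih =>
    rw [← add_assoc, Finset.sum_range_succ, ih, if_pos (by omega), ← add_assoc]
    unfold harm
    rw [Finset.sum_range_succ _ (j + k)]
    push_cast
    ring

/-- The number of orders in which the maximum arrives at position `t` and the best of the
preceding values at position `s < t` is `n! / (n t)`. -/
theorem card_filter_max_at_and_prefix_max_at {n : ℕ} (v : Fin n → ℝ)
    (hv : Function.Injective v) (s t : Fin n) (hst : s < t) :
    ((Finset.univ.filter (fun π : Equiv.Perm (Fin n) =>
        (∀ r, v (π r) ≤ v (π t)) ∧ ∀ r, r < t → v (π r) ≤ v (π s))).card : ℝ)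
      = n.factorial / n * (1 / (t : ℕ)) := by
  have h1 := card_mul_card_filter_max_at v hv Finset.univ (fun _ => True)
    (fun _ _ _ _ _ _ => trivial) t (Finset.mem_univ t)
  have h2 := card_mul_card_filter_max_at v hv (Finset.Iio t)
    (fun π => ∀ r, v (π r) ≤ v (π t)) ?_ s (Finset.mem_Iio.mpr hst)
  · simp only [Finset.mem_univ, true_and, forall_const, Finset.card_univ, Fintype.card_fin,
      Finset.filter_true, Fintype.card_perm, Finset.mem_Iio, Fin.card_Iio] at h1 h2
    have hn : (n : ℝ) ≠ 0 := Nat.cast_ne_zero.mpr (by have := t.isLt; omega)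
    have ht : ((t : ℕ) : ℝ) ≠ 0 := Nat.cast_ne_zero.mpr (by have := Fin.lt_def.mp hst; omega)
    have h3 := congrArg (Nat.cast (R := ℝ))
      (h1.symm.trans (congrArg (n * ·) (by convert h2.symm)))
    push_cast at h3
    field_simp
    linarith
  · intro π a ha b hb h r
    rw [Finset.mem_Iio] at ha hb
    rw [Equiv.Perm.mul_apply, Equiv.Perm.mul_apply, Equiv.swap_apply_of_ne_of_ne ha.ne' hb.ne']
    exact h _

/-- **Exact success probability of wait-and-pick.**
For `n ≥ 2`, a checkpoint `m ∈ {1,…,n−1}` and an injective value assignment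
`v`, the wait-and-pick algorithm with checkpoint `m` under a uniformly random
arrival order selects the item of maximum value with probability exactly
`f(n,m) = (m/n)·(H_{n−1} − H_{m−1})`. -/
theorem wait_and_pick_success_probability
    (n m : ℕ) (hn : 2 ≤ n) (hm1 : 1 ≤ m) (hm2 : m ≤ n - 1)
    (v : Fin n → ℝ) (hv : Function.Injective v) :
    ((Finset.univ.filter (fun π : Equiv.Perm (Fin n) =>
        wpSucceeds m (fun t => v (π t)))).card : ℝ) / (Nat.factorial n)
      = ((m : ℝ) / n) * (harm (n - 1) - harm (m - 1)) := by
  have hset : Finset.univ.filter (fun π : Equiv.Perm (Fin n) =>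
        wpSucceeds m (fun t => v (π t)))
      = ((Finset.univ.filter (fun t : Fin n => m ≤ (t : ℕ))) ×ˢ
          (Finset.univ.filter (fun s : Fin n => (s : ℕ) < m))).biUnion
        (fun p => Finset.univ.filter (fun π : Equiv.Perm (Fin n) =>
          (∀ r, v (π r) ≤ v (π p.1)) ∧ ∀ r, r < p.1 → v (π r) ≤ v (π p.2))) := by
    ext π
    simp only [Finset.mem_filter, Finset.mem_univ, true_and, Finset.mem_biUnion,
      Finset.mem_product, Prod.exists]
    rw [wpSucceeds_iff hm1 (by omega) (fun t => v (π t)) (hv.comp π.injective)]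
    simp only [and_assoc]
  have hcard : (Finset.univ.filter (fun s : Fin n => (s : ℕ) < m)).card = m := by
    rw [Fin.card_filter_val_lt]
    omega
  rw [hset, Finset.card_biUnion]
  · push_cast
    rw [Finset.sum_product]
    have hsum : ∀ t ∈ Finset.univ.filter (fun t : Fin n => m ≤ (t : ℕ)),
        ∑ s ∈ Finset.univ.filter (fun s : Fin n => (s : ℕ) < m),
          ((Finset.univ.filter (fun π : Equiv.Perm (Fin n) =>
            (∀ r, v (π r) ≤ v (π t)) ∧ ∀ r, r < t → v (π r) ≤ v (π s))).card : ℝ)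
        = m * (n.factorial / n) * (1 / (t : ℕ)) := by
      intro t ht
      rw [Finset.sum_congr rfl (fun s hs => card_filter_max_at_and_prefix_max_at v hv s t ?_),
        Finset.sum_const, hcard, nsmul_eq_mul, mul_assoc]
      simp only [Finset.mem_filter, Finset.mem_univ, true_and] at ht hs
      exact Fin.lt_def.mpr (by omega)
    rw [Finset.sum_congr rfl hsum, ← Finset.mul_sum, Finset.sum_filter,
      Fin.sum_univ_eq_sum_range (fun t => if m ≤ t then (1 : ℝ) / t else 0) n]
    obtain ⟨j, rfl⟩ : ∃ j, m = j + 1 := ⟨m - 1, by omega⟩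
    obtain ⟨k, rfl⟩ : ∃ k, n = j + 1 + k := ⟨n - (j + 1), by omega⟩
    rw [sum_range_ite_eq_harm_sub, show j + 1 + k - 1 = j + k by omega, Nat.add_sub_cancel]
    have hf : ((j + 1 + k).factorial : ℝ) ≠ 0 := Nat.cast_ne_zero.mpr (Nat.factorial_ne_zero _)
    field_simp
  · rintro ⟨t, s⟩ hp ⟨t', s'⟩ hq hne
    rw [Function.onFun, Finset.disjoint_left]
    intro π h1 h2
    simp only [Finset.mem_filter, Finset.mem_univ, true_and, Finset.coe_product,
      Finset.coe_filter, Set.mem_prod, Set.mem_ofPred_eq] at h1 h2 hp hq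
    obtain rfl : t = t' := π.injective (hv (le_antisymm (h2.1 t) (h1.1 t')))
    refine hne (Prod.ext rfl (π.injective (hv (le_antisymm (h2.2 s ?_) (h1.2 s' ?_)))))
    · exact Fin.lt_def.mpr (by omega)
    · exact Fin.lt_def.mpr (by omega)
end

section
/- Let ℓ ≥ 2 and 1 ≤ m ≤ ℓ−1 be integers, let r ≥ 1 be an integer with r ≤ ℓ − m, and let a, b_1, …, b_r be r+1 pairwise distinct elements of [ℓ]. If π is a permutation of [ℓ] drawn uniformly at random, then the probability that simultaneously (i) π^{-1}(a) ≤ m, (ii) π^{-1}(b_j) > m for all j ∈ {1,…,r}, and (iii) π^{-1}(b_1) < π^{-1}(b_j) for all j ∈ {2,…,r}, equals (m/ℓ) · (1/r) · ∏_{j=1}^{r} (ℓ − m − j + 1)/(ℓ − j). -/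
open scoped Classical

open Finset Equiv

section SymmetricCounting

variable {ι α : Type*}

/-- Two predicates on permutations that differ by a right translation have equally many solutions. -/
theorem card_filter_perm_eq_of_mul_right [Fintype α] [DecidableEq α]
    {P Q : Perm α → Prop} [DecidablePred P] [DecidablePred Q] (τ : Perm α)
    (h : ∀ σ, P σ ↔ Q (σ * τ)) :
    #{σ | P σ} = #{σ | Q σ} :=
  Finset.card_equiv (Equiv.mulRight τ) (by simp [h])

/-- If the sets `{w ∈ W | R x w}`, for `x ∈ s`, are equinumerous, and every `w ∈ W` lies in
exactly `k` of them, then each of them has `k * #W / #s` elements. -/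
theorem card_mul_card_filter_eq {β : Type*} (s : Finset ι) (W : Finset β) (R : ι → β → Prop)
    [∀ x w, Decidable (R x w)] {k : ℕ} (hk : ∀ w ∈ W, #{x ∈ s | R x w} = k) {y : ι}
    (hy : ∀ x ∈ s, #{w ∈ W | R x w} = #{w ∈ W | R y w}) :
    #s * #{w ∈ W | R y w} = #W * k := by
  have h := Finset.sum_card_bipartiteAbove_eq_sum_card_bipartiteBelow R (s := s) (t := W)
  simp only [bipartiteAbove, bipartiteBelow] at h
  rwa [Finset.sum_congr rfl hy, Finset.sum_congr rfl hk, sum_const, sum_const,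
    smul_eq_mul, smul_eq_mul] at h

end SymmetricCounting

/-- The permutations `σ` (listing positions) that put `a` before the checkpoint `m` and every
element of `B` after it. -/
noncomputable def splitPerms {ℓ : ℕ} (m : ℕ) (a : Fin ℓ) (B : Finset (Fin ℓ)) :
    Finset (Perm (Fin ℓ)) :=
  {σ | (σ a : ℕ) < m ∧ ∀ x ∈ B, m ≤ (σ x : ℕ)}

theorem card_filter_perm_lt {ℓ m : ℕ} (hm : m ≤ ℓ) (σ : Perm (Fin ℓ)) :
    #{x | (σ x : ℕ) < m} = m := by
  have h : #{x | (σ x : ℕ) < m} = #{y : Fin ℓ | (y : ℕ) < m} :=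
    Finset.card_equiv σ (by simp)
  rw [h, Fin.card_filter_val_lt, min_eq_right hm]

theorem card_splitPerms_empty {ℓ m : ℕ} (hm : m ≤ ℓ) (a : Fin ℓ) :
    ℓ * #(splitPerms m a ∅) = ℓ.factorial * m := by
  have h := card_mul_card_filter_eq univ univ (fun x (σ : Perm (Fin ℓ)) => (σ x : ℕ) < m)
    (k := m) (fun σ _ => card_filter_perm_lt hm σ) (y := a)
    (fun x _ => card_filter_perm_eq_of_mul_right (swap a x) (by simp))
  simpa [splitPerms, Fintype.card_perm] using h

theorem card_splitPerms_insert {ℓ m : ℕ} (hm : m ≤ ℓ) {a y : Fin ℓ} {B : Finset (Fin ℓ)}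
    (ha : a ∉ B) (hya : y ≠ a) (hy : y ∉ B) :
    ((ℓ : ℝ) - (#B + 1)) * #(splitPerms m a (insert y B)) =
      #(splitPerms m a B) * ((ℓ : ℝ) - m - #B) := by
  have hinsert : ∀ x, splitPerms m a (insert x B) =
      {σ ∈ splitPerms m a B | m ≤ (σ x : ℕ)} := by
    intro x
    ext σ
    simp only [splitPerms, mem_filter, mem_univ, true_and, forall_mem_insert]
    tauto
  have hcount : ∀ σ ∈ splitPerms m a B,
      #{x ∈ (insert a B)ᶜ | m ≤ (σ x : ℕ)} = ℓ - m - #B := by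
    intro σ hσ
    simp only [splitPerms, mem_filter, mem_univ, true_and] at hσ
    have hset : ({x ∈ (insert a B)ᶜ | m ≤ (σ x : ℕ)} : Finset (Fin ℓ)) =
        ({x | (σ x : ℕ) < m} : Finset (Fin ℓ))ᶜ \ B := by
      ext x
      simp only [mem_filter, mem_compl, mem_insert, mem_sdiff, mem_univ, true_and, not_or, not_lt]
      refine ⟨fun h => ⟨h.2, h.1.2⟩, fun h => ⟨⟨?_, h.2⟩, h.1⟩⟩
      rintro rfl
      omega
    rw [hset, card_sdiff_of_subset, card_compl, card_filter_perm_lt hm, Fintype.card_fin]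
    intro x hx
    simpa using hσ.2 x hx
  have hle : ∀ σ ∈ splitPerms m a B, #B ≤ ℓ - m := by
    intro σ hσ
    simp only [splitPerms, mem_filter, mem_univ, true_and] at hσ
    have hsub : B ⊆ ({x | (σ x : ℕ) < m} : Finset (Fin ℓ))ᶜ := by
      intro x hx
      simpa using hσ.2 x hx
    have h := card_le_card hsub
    rwa [card_compl, card_filter_perm_lt hm, Fintype.card_fin] at h
  have hsymm : ∀ x ∈ (insert a B)ᶜ, #{σ ∈ splitPerms m a B | m ≤ (σ x : ℕ)} =
      #{σ ∈ splitPerms m a B | m ≤ (σ y : ℕ)} := by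
    intro x hx
    simp only [mem_compl, mem_insert, not_or] at hx
    simp only [splitPerms, filter_filter]
    refine card_filter_perm_eq_of_mul_right (swap x y) fun σ => ?_
    have hB : ∀ z ∈ B, swap x y z = z := fun z hz =>
      swap_apply_of_ne_of_ne (by rintro rfl; exact hx.2 hz) (by rintro rfl; exact hy hz)
    simp +contextual [swap_apply_of_ne_of_ne (Ne.symm hx.1) hya.symm, hB]
  have h := card_mul_card_filter_eq _ _ (fun x (σ : Perm (Fin ℓ)) => m ≤ (σ x : ℕ)) hcount hsymm
  rw [← hinsert, card_compl, card_insert_of_notMem ha, Fintype.card_fin] at h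
  have hcard : #B + 1 ≤ ℓ := by
    simpa [card_insert_of_notMem ha] using card_le_univ (insert a B)
  have h' := congrArg (Nat.cast (R := ℝ)) h
  rw [Nat.cast_mul, Nat.cast_mul, Nat.cast_sub hcard] at h'
  push_cast at h'
  rw [h']
  rcases (splitPerms m a B).eq_empty_or_nonempty with h0 | ⟨σ, hσ⟩
  · simp [h0]
  · rw [Nat.cast_sub (hle σ hσ), Nat.cast_sub hm]

theorem card_splitPerms_div_factorial {ℓ m : ℕ} (hm : m ≤ ℓ) (a : Fin ℓ)
    (B : Finset (Fin ℓ)) (ha : a ∉ B) :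
    (#(splitPerms m a B) : ℝ) / ℓ.factorial =
      (m : ℝ) / ℓ * ∏ j ∈ Icc 1 #B, (((ℓ : ℝ) - m - j + 1) / ((ℓ : ℝ) - j)) := by
  have hfac : (ℓ.factorial : ℝ) ≠ 0 := by positivity
  induction B using Finset.induction_on with
  | empty =>
    have hℓ : (ℓ : ℝ) ≠ 0 := by exact_mod_cast (Fin.pos a).ne'
    have h := congrArg (Nat.cast (R := ℝ)) (card_splitPerms_empty hm a)
    push_cast at h
    simp only [card_empty, zero_lt_one, Icc_eq_empty_of_lt, prod_empty, mul_one]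
    rw [div_eq_div_iff hfac hℓ]
    linarith
  | insert y B hy ih =>
    rw [mem_insert, not_or] at ha
    have h := card_splitPerms_insert hm ha.2 (Ne.symm ha.1) hy
    have hcard : #B + 1 < ℓ := by
      have := card_le_univ (insert a (insert y B))
      rw [card_insert_of_notMem (by simpa using ha), card_insert_of_notMem hy,
        Fintype.card_fin] at this
      omega
    have hpos : (ℓ : ℝ) - (#B + 1) ≠ 0 := by
      have : ((#B : ℝ) + 1) < ℓ := by exact_mod_cast hcard
      linarith
    rw [card_insert_of_notMem hy, prod_Icc_succ_top (by omega), ← mul_assoc, ← ih ha.2]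
    push_cast
    field_simp
    linarith

/-- By symmetry, each element of an injective family is the first one among the family in a
`1 / r` fraction of the permutations in `splitPerms`. -/
theorem mul_card_filter_first_splitPerms {ℓ m r : ℕ} (a : Fin ℓ) (b : Fin r → Fin ℓ)
    (hb : Function.Injective b) (hab : ∀ j, b j ≠ a) (k : Fin r) :
    r * #{σ ∈ splitPerms m a (univ.image b) | ∀ j, j ≠ k → (σ (b k) : ℕ) < σ (b j)} =
      #(splitPerms m a (univ.image b)) := by
  have h := card_mul_card_filter_eq univ (splitPerms m a (univ.image b))
    (fun k (σ : Perm (Fin ℓ)) => ∀ j, j ≠ k → (σ (b k) : ℕ) < σ (b j)) (k := 1) (y := k) ?_ ?_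
  · simpa using h
  · intro σ _
    obtain ⟨i, -, hi⟩ := exists_min_image univ (fun j => (σ (b j) : ℕ)) ⟨k, mem_univ k⟩
    rw [card_eq_one]
    refine ⟨i, ?_⟩
    ext j
    simp only [mem_filter, mem_univ, true_and, mem_singleton]
    constructor
    · intro hj
      by_contra hne
      exact absurd (hi j (mem_univ j)) (not_le.mpr (hj i (Ne.symm hne)))
    · rintro rfl i hne
      refine lt_of_le_of_ne (hi i (mem_univ i)) fun h => hne ?_
      exact (hb (σ.injective (Fin.ext h))).symm
  · intro i _
    simp only [splitPerms, filter_filter]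
    refine card_filter_perm_eq_of_mul_right (swap (b i) (b k)) fun σ => ?_
    have hσ : ∀ j, (σ * swap (b i) (b k)) (b j) = σ (b (swap i k j)) := by
      intro j
      rw [Perm.mul_apply, hb.swap_apply]
    have ha : (σ * swap (b i) (b k)) a = σ a := by
      rw [Perm.mul_apply, swap_apply_of_ne_of_ne (hab i).symm (hab k).symm]
    simp only [mem_image, mem_univ, true_and, forall_exists_index, forall_apply_eq_imp_iff,
      hσ, ha, swap_apply_right]
    refine and_congr (and_congr Iff.rfl ?_) ?_
    · exact (swap i k).forall_congr_left.trans (by simp)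
    · refine (swap i k).forall_congr_left.trans (forall_congr' fun j => ?_)
      rw [symm_swap, Ne, swap_apply_eq_iff, swap_apply_left]

/-- **Exact probability of the event `E_{r+1}`.**
For a uniformly random permutation `π` of `[ℓ]`, distinct elements
`a, b_1, …, b_r`, and a checkpoint `m`, the probability that `a` lands among the
first `m` positions, all `b_j` land after position `m`, and `b_1` comes first
among the `b_j`'s, equals `(m/ℓ)·(1/r)·∏_{j=1}^r (ℓ−m−j+1)/(ℓ−j)`.
(Positions are 0-based: position `< m` means 1-based position `≤ m`.) -/
theorem wait_and_pick_event_probability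
    (ℓ m r : ℕ) (hℓ : 2 ≤ ℓ) (hm1 : 1 ≤ m) (hm2 : m ≤ ℓ - 1)
    (hr1 : 1 ≤ r) (hr2 : r ≤ ℓ - m)
    (a : Fin ℓ) (b : Fin r → Fin ℓ) (hb : Function.Injective b)
    (hab : ∀ j, b j ≠ a) :
    ((Finset.univ.filter (fun π : Equiv.Perm (Fin ℓ) =>
        ((π.symm a : ℕ) < m) ∧
        (∀ j : Fin r, m ≤ (π.symm (b j) : ℕ)) ∧
        (∀ j : Fin r, j ≠ ⟨0, by omega⟩ →
          (π.symm (b ⟨0, by omega⟩) : ℕ) < (π.symm (b j) : ℕ)))).card : ℝ) /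
      (Nat.factorial ℓ)
    = ((m : ℝ) / ℓ) * (1 / r) *
        ∏ j ∈ Finset.Icc 1 r, (((ℓ : ℝ) - m - j + 1) / ((ℓ : ℝ) - j)) := by
  have hm : m ≤ ℓ := by omega
  have hr : (r : ℝ) ≠ 0 := by exact_mod_cast (by omega : r ≠ 0)
  have hcard : #(univ.image b) = r := by simp [card_image_of_injective _ hb]
  have hprob := card_splitPerms_div_factorial hm a (univ.image b) (by simpa using hab)
  have hfirst := congrArg (Nat.cast (R := ℝ))
    (mul_card_filter_first_splitPerms (m := m) a b hb hab ⟨0, by omega⟩)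
  rw [hcard, ← hfirst] at hprob
  rw [mul_right_comm, ← hprob, Nat.cast_mul, mul_div_assoc, mul_comm (r : ℝ), mul_one_div,
    mul_div_cancel_right₀ _ hr]
  congr 2
  refine Finset.card_equiv (Equiv.inv (Perm (Fin ℓ))) fun π => ?_
  simp [splitPerms, and_assoc]
end
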